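/- arXiv:math/9209202 — 3 statements merged into one kernel-verified Lean document; each statement's English description precedes it below -/
import Mathlib

section
/- Let (P,·,∘) be an algebra satisfying (ALΣ) and generated by a single element 1 (under both operations), and let (A,·) be the subalgebra of (P,·) generated by 1 under · alone. Then P is free with respect to (ALΣ) (i.e. the canonical surjection from W_P/≡_P onto P is injective) if and only if A is free with respect to the left distributive law (i.e. the canonical surjection from W_A/≡ onto A is injective). -/
/-- Words built from a single generator `1` using one binary operation `·`. -/
inductive WA : Type
  | one : WA
  | mul : WA → WA → WA

/-- Words built from a single generator `1` using two binary operations `·` and `∘`. -/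
inductive WP : Type
  | one : WP
  | mul : WP → WP → WP
  | comp : WP → WP → WP

/-- The smallest congruence on `W_A` containing all instances of the
left distributive law `a·(b·c) = (a·b)·(a·c)`. -/
inductive LDEq : WA → WA → Prop
  | refl (a : WA) : LDEq a a
  | symm {a b : WA} : LDEq a b → LDEq b a
  | trans {a b c : WA} : LDEq a b → LDEq b c → LDEq a c
  | congr {a a' b b' : WA} : LDEq a a' → LDEq b b' → LDEq (a.mul b) (a'.mul b')
  | ld (a b c : WA) : LDEq (a.mul (b.mul c)) ((a.mul b).mul (a.mul c))

/-- The smallest congruence on `W_P` (with respect to both operations)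
containing all instances of Laver's laws (ALΣ). -/
inductive PEq : WP → WP → Prop
  | refl (a : WP) : PEq a a
  | symm {a b : WP} : PEq a b → PEq b a
  | trans {a b c : WP} : PEq a b → PEq b c → PEq a c
  | congr_mul {a a' b b' : WP} : PEq a a' → PEq b b' → PEq (a.mul b) (a'.mul b')
  | congr_comp {a a' b b' : WP} : PEq a a' → PEq b b' → PEq (a.comp b) (a'.comp b')
  | assoc (a b c : WP) : PEq (a.comp (b.comp c)) ((a.comp b).comp c)
  | comp_mul (a b c : WP) : PEq ((a.comp b).mul c) (a.mul (b.mul c))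
  | mul_comp (a b c : WP) : PEq (a.mul (b.comp c)) ((a.mul b).comp (a.mul c))
  | comp_eq (a b : WP) : PEq (a.comp b) ((a.mul b).comp a)

/-- Laver's laws (ALΣ) for two binary operations `mul` (`·`) and `comp` (`∘`). -/
def ALSigma {α : Type*} (mul comp : α → α → α) : Prop :=
  (∀ a b c : α, comp a (comp b c) = comp (comp a b) c) ∧
  (∀ a b c : α, mul (comp a b) c = mul a (mul b c)) ∧
  (∀ a b c : α, mul a (comp b c) = comp (mul a b) (mul a c)) ∧
  (∀ a b : α, comp a b = comp (mul a b) a)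

/-- Evaluation of a word of `W_A` in an algebra with operation `mul` and
generator `one`; this induces the canonical surjection from `W_A/≡` onto the
subalgebra `A` generated by `one` under `·` alone. -/
def evalWA {α : Type*} (mul : α → α → α) (one : α) : WA → α
  | WA.one => one
  | WA.mul a b => mul (evalWA mul one a) (evalWA mul one b)

/-- Evaluation of a word of `W_P` in an algebra with operations `mul`, `comp` and
generator `one`; this induces the canonical surjection from `W_P/≡_P` onto `P`. -/
def evalWP {α : Type*} (mul comp : α → α → α) (one : α) : WP → α
  | WP.one => one
  | WP.mul a b => mul (evalWP mul comp one a) (evalWP mul comp one b)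
  | WP.comp a b => comp (evalWP mul comp one a) (evalWP mul comp one b)

/-- The congruence on words of `W_A`-terms, read as compositions, generated by `≡` on letters and
by `a ∘ b = (a · b) ∘ a`. -/
inductive WordEq : List WA → List WA → Prop
  | refl (l : List WA) : WordEq l l
  | symm {l m : List WA} : WordEq l m → WordEq m l
  | trans {l m n : List WA} : WordEq l m → WordEq m n → WordEq l n
  | cons {a b : WA} {l m : List WA} : LDEq a b → WordEq l m → WordEq (a :: l) (b :: m)
  | swap (a b : WA) (l : List WA) : WordEq (a :: b :: l) (a.mul b :: a :: l)

namespace WA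

/-- The action `a₁ · (a₂ · ⋯ (aₙ · w))` of a word on a term. -/
def act (l : List WA) (w : WA) : WA := l.foldr mul w

/-- The left factors along the right spine of a term. -/
def spine : WA → List WA
  | one => []
  | mul a b => a :: b.spine

/-- The inclusion of `W_A` in `W_P`. -/
def toWP_s9 : WA → WP
  | one => WP.one
  | mul a b => a.toWP_s9.mul b.toWP_s9

theorem spine_act_one (l : List WA) : (act l one).spine = l := by
  induction l with
  | nil => rfl
  | cons a l ih => exact congrArg (a :: ·) ih

theorem act_append (l m : List WA) (w : WA) : act (l ++ m) w = act l (act m w) :=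
  List.foldr_append

theorem act_mul (l : List WA) (a b : WA) :
    LDEq (act l (a.mul b)) ((act l a).mul (act l b)) := by
  induction l with
  | nil => exact .refl _
  | cons c l ih => exact (LDEq.congr (.refl c) ih).trans (.ld ..)

theorem act_congr_right (l : List WA) {a b : WA} (h : LDEq a b) :
    LDEq (act l a) (act l b) := by
  induction l with
  | nil => exact h
  | cons c l ih => exact LDEq.congr (.refl c) ih

theorem act_congr_left {l m : List WA} (h : WordEq l m) (w : WA) :
    LDEq (act l w) (act m w) := by
  induction h with
  | refl => exact .refl _
  | symm _ ih => exact ih.symm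
  | trans _ _ ih₁ ih₂ => exact ih₁.trans ih₂
  | cons h _ ih => exact LDEq.congr h ih
  | swap a b l => exact .ld a b (act l w)

theorem _root_.LDEq.wordEq_spine {a b : WA} (h : LDEq a b) : WordEq a.spine b.spine := by
  induction h with
  | refl => exact .refl _
  | symm _ ih => exact ih.symm
  | trans _ _ ih₁ ih₂ => exact ih₁.trans ih₂
  | congr h _ _ ih => exact .cons h ih
  | ld a b c => exact .swap a b c.spine

theorem _root_.LDEq.toWP_s9 {a b : WA} (h : LDEq a b) : PEq a.toWP_s9 b.toWP_s9 := by
  induction h with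
  | refl => exact .refl _
  | symm _ ih => exact ih.symm
  | trans _ _ ih₁ ih₂ => exact ih₁.trans ih₂
  | congr _ _ ih₁ ih₂ => exact .congr_mul ih₁ ih₂
  | ld a b c =>
    exact (PEq.comp_mul ..).symm.trans
      ((PEq.congr_mul (.comp_eq ..) (.refl _)).trans (.comp_mul ..))

theorem evalWP_toWP {α : Type*} (mul comp : α → α → α) (one : α) (a : WA) :
    evalWP mul comp one a.toWP_s9 = evalWA mul one a := by
  induction a with
  | one => rfl
  | mul a b iha ihb => simp only [toWP_s9, evalWP, evalWA, iha, ihb]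

end WA

namespace WordEq

theorem length_eq {l m : List WA} (h : WordEq l m) : l.length = m.length := by
  induction h with
  | refl => rfl
  | symm _ ih => exact ih.symm
  | trans _ _ ih₁ ih₂ => exact ih₁.trans ih₂
  | cons _ _ ih => simp [ih]
  | swap => rfl

theorem ldEq_of_singleton {l m : List WA} (h : WordEq l m) :
    ∀ {a b : WA}, l = [a] → m = [b] → LDEq a b := by
  induction h with
  | refl =>
    rintro a b rfl h
    cases h
    exact .refl _
  | symm _ ih => exact fun ha hb => (ih hb ha).symm
  | trans h₁ _ ih₁ ih₂ =>
    rintro a b rfl hb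
    obtain ⟨c, rfl⟩ := List.length_eq_one_iff.1 h₁.length_eq.symm
    exact (ih₁ rfl rfl).trans (ih₂ rfl hb)
  | cons h _ _ =>
    intro a b ha hb
    cases ha
    cases hb
    exact h
  | swap => exact fun ha => by simp at ha

theorem append_left (n : List WA) {l m : List WA} (h : WordEq l m) :
    WordEq (n ++ l) (n ++ m) := by
  induction n with
  | nil => exact h
  | cons a n ih => exact .cons (.refl a) ih

theorem append_right {l m : List WA} (h : WordEq l m) (n : List WA) :
    WordEq (l ++ n) (m ++ n) := by
  induction h with
  | refl => exact .refl _
  | symm _ ih => exact ih.symm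
  | trans _ _ ih₁ ih₂ => exact ih₁.trans ih₂
  | cons h _ ih => exact .cons h ih
  | swap => exact .swap ..

theorem map_act {l m : List WA} (n : List WA) (h : WordEq l m) :
    WordEq (l.map (WA.act n)) (m.map (WA.act n)) := by
  induction h with
  | refl => exact .refl _
  | symm _ ih => exact ih.symm
  | trans _ _ ih₁ ih₂ => exact ih₁.trans ih₂
  | cons h _ ih => exact .cons (WA.act_congr_right n h) ih
  | swap a b l => exact (WordEq.swap ..).trans (.cons (WA.act_mul n a b).symm (.refl _))

theorem map_act_congr {l m : List WA} (h : WordEq l m) (n : List WA) :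
    WordEq (n.map (WA.act l)) (n.map (WA.act m)) := by
  induction n with
  | nil => exact .refl _
  | cons a n ih => exact .cons (WA.act_congr_left h a) ih

theorem append_singleton (l : List WA) (a : WA) : WordEq (l ++ [a]) (WA.act l a :: l) := by
  induction l with
  | nil => exact .refl _
  | cons c l ih => exact (WordEq.cons (.refl c) ih).trans (.swap ..)

theorem append_eq_map_act_append (l m : List WA) :
    WordEq (l ++ m) (m.map (WA.act l) ++ l) := by
  induction m with
  | nil => simpa using WordEq.refl l
  | cons a m ih =>
    have h := (append_singleton l a).append_right m
    rw [List.append_assoc] at h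
    exact h.trans (.cons (.refl _) ih)

end WordEq

/-- The composition of the letters of a nonempty word (with `1` as a default value). -/
def WP.ofWord : List WA → WP
  | [] => WP.one
  | [a] => a.toWP_s9
  | a :: b :: l => a.toWP_s9.comp (WP.ofWord (b :: l))

namespace WP

/-- A word of `W_A`-terms whose composition is equivalent to the given term. -/
def toWord : WP → List WA
  | one => [WA.one]
  | mul a b => b.toWord.map (WA.act a.toWord)
  | comp a b => a.toWord ++ b.toWord

theorem toWord_ne_nil (p : WP) : p.toWord ≠ [] := by
  induction p with
  | one => simp [toWord]
  | mul a b _ ih => simpa [toWord] using ih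
  | comp a b ih _ => simp [toWord, ih]

theorem toWord_toWP (a : WA) : a.toWP_s9.toWord = [a] := by
  induction a with
  | one => rfl
  | mul a b iha ihb => simp [WA.toWP_s9, toWord, iha, ihb, WA.act]

theorem ofWord_cons (a : WA) {l : List WA} (hl : l ≠ []) :
    ofWord (a :: l) = a.toWP_s9.comp (ofWord l) := by
  cases l with
  | nil => exact absurd rfl hl
  | cons b l => rfl

theorem ofWord_append {l m : List WA} (hl : l ≠ []) (hm : m ≠ []) :
    PEq (ofWord (l ++ m)) ((ofWord l).comp (ofWord m)) := by
  induction l with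
  | nil => exact absurd rfl hl
  | cons a l ih =>
    rcases eq_or_ne l [] with rfl | h
    · rw [List.singleton_append, ofWord_cons a hm]
      exact .refl _
    · rw [List.cons_append, ofWord_cons a h, ofWord_cons a (by simp [h])]
      exact (PEq.congr_comp (.refl _) (ih h)).trans (.assoc ..)

theorem ofWord_mul_toWP {l : List WA} (hl : l ≠ []) (w : WA) :
    PEq ((ofWord l).mul w.toWP_s9) (WA.act l w).toWP_s9 := by
  induction l with
  | nil => exact absurd rfl hl
  | cons a l ih =>
    rcases eq_or_ne l [] with rfl | h
    · exact .refl _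
    · rw [ofWord_cons a h]
      exact (PEq.comp_mul ..).trans (.congr_mul (.refl _) (ih h))

theorem ofWord_mul_ofWord {l m : List WA} (hl : l ≠ []) (hm : m ≠ []) :
    PEq ((ofWord l).mul (ofWord m)) (ofWord (m.map (WA.act l))) := by
  induction m with
  | nil => exact absurd rfl hm
  | cons a m ih =>
    rcases eq_or_ne m [] with rfl | h
    · exact ofWord_mul_toWP hl a
    · rw [ofWord_cons a h, List.map_cons, ofWord_cons _ (by simpa using h)]
      exact (PEq.mul_comp ..).trans (.congr_comp (ofWord_mul_toWP hl a) (ih h))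

theorem ofWord_toWord (p : WP) : PEq (ofWord p.toWord) p := by
  induction p with
  | one => exact .refl _
  | mul a b iha ihb =>
    exact (ofWord_mul_ofWord a.toWord_ne_nil b.toWord_ne_nil).symm.trans (.congr_mul iha ihb)
  | comp a b iha ihb =>
    exact (ofWord_append a.toWord_ne_nil b.toWord_ne_nil).trans (.congr_comp iha ihb)

theorem mul_toWP (p : WP) (w : WA) : PEq (p.mul w.toWP_s9) (WA.act p.toWord w).toWP_s9 :=
  (PEq.congr_mul p.ofWord_toWord.symm (.refl _)).trans (ofWord_mul_toWP p.toWord_ne_nil w)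

end WP

theorem WordEq.ofWord {l m : List WA} (h : WordEq l m) : PEq (WP.ofWord l) (WP.ofWord m) := by
  induction h with
  | refl => exact .refl _
  | symm _ ih => exact ih.symm
  | trans _ _ ih₁ ih₂ => exact ih₁.trans ih₂
  | @cons a b l m h hlm ih =>
    rcases eq_or_ne l [] with rfl | hl
    · obtain rfl := List.length_eq_zero_iff.1 hlm.length_eq.symm
      exact h.toWP_s9
    · have hm : m ≠ [] := by
        rwa [← List.length_pos_iff, ← hlm.length_eq, List.length_pos_iff]
      rw [WP.ofWord_cons a hl, WP.ofWord_cons b hm]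
      exact .congr_comp h.toWP_s9 ih
  | swap a b l =>
    cases l with
    | nil => exact .comp_eq ..
    | cons c l =>
      exact (PEq.assoc ..).trans ((PEq.congr_comp (.comp_eq ..) (.refl _)).trans (PEq.assoc ..).symm)

theorem PEq.wordEq_toWord {p q : WP} (h : PEq p q) : WordEq p.toWord q.toWord := by
  induction h with
  | refl => exact .refl _
  | symm _ ih => exact ih.symm
  | trans _ _ ih₁ ih₂ => exact ih₁.trans ih₂
  | congr_mul _ _ ih₁ ih₂ => exact (ih₂.map_act _).trans (ih₁.map_act_congr _)
  | congr_comp _ _ ih₁ ih₂ => exact (ih₁.append_right _).trans (ih₂.append_left _)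
  | assoc a b c =>
    simpa only [WP.toWord, List.append_assoc] using WordEq.refl _
  | comp_mul a b c =>
    have h : WA.act (a.toWord ++ b.toWord) = WA.act a.toWord ∘ WA.act b.toWord :=
      funext (WA.act_append _ _)
    simpa only [WP.toWord, List.map_map, h] using WordEq.refl _
  | mul_comp a b c =>
    simpa only [WP.toWord, List.map_append] using WordEq.refl _
  | comp_eq a b => exact .append_eq_map_act_append _ _

theorem PEq.evalWP_eq {α : Type*} {mul comp : α → α → α} (one : α) (hlaws : ALSigma mul comp)
    {p q : WP} (h : PEq p q) : evalWP mul comp one p = evalWP mul comp one q := by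
  induction h with
  | refl => rfl
  | symm _ ih => exact ih.symm
  | trans _ _ ih₁ ih₂ => exact ih₁.trans ih₂
  | congr_mul _ _ ih₁ ih₂ => exact congrArg₂ mul ih₁ ih₂
  | congr_comp _ _ ih₁ ih₂ => exact congrArg₂ comp ih₁ ih₂
  | assoc => exact hlaws.1 _ _ _
  | comp_mul => exact hlaws.2.1 _ _ _
  | mul_comp => exact hlaws.2.2.1 _ _ _
  | comp_eq => exact hlaws.2.2.2 _ _

theorem stmt_9 {P : Type*} (mul comp : P → P → P) (one : P)
    (hlaws : ALSigma mul comp)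
    (hgen : ∀ s : Set P, one ∈ s → (∀ x ∈ s, ∀ y ∈ s, mul x y ∈ s) →
      (∀ x ∈ s, ∀ y ∈ s, comp x y ∈ s) → ∀ x : P, x ∈ s) :
    (∀ p q : WP, evalWP mul comp one p = evalWP mul comp one q → PEq p q) ↔
    (∀ a b : WA, evalWA mul one a = evalWA mul one b → LDEq a b) := by
  constructor
  · intro hP a b hab
    rw [← WA.evalWP_toWP mul comp, ← WA.evalWP_toWP mul comp] at hab
    exact (hP _ _ hab).wordEq_toWord.ldEq_of_singleton (WP.toWord_toWP a) (WP.toWord_toWP b)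
  · intro hA p q hpq
    have eval_act (r : WP) : evalWA mul one (WA.act r.toWord WA.one) =
        mul (evalWP mul comp one r) one := by
      rw [← WA.evalWP_toWP mul comp]
      exact ((r.mul_toWP WA.one).evalWP_eq one hlaws).symm
    have h := (hA _ _ ((eval_act p).trans
      ((congrArg (mul · one) hpq).trans (eval_act q).symm))).wordEq_spine
    rw [WA.spine_act_one, WA.spine_act_one] at h
    exact p.ofWord_toWord.symm.trans (h.ofWord.trans q.ofWord_toWord)
end

section
/- The following are equivalent: (i) A_∞ is free, i.e. ≡_∞ coincides with ≡ on W_A; (ii) P_∞ is free, i.e. ≡_∞ coincides with ≡_P on W_P; (iii) A_∞ satisfies left cancellation: if c·a ≡_∞ c·b for words a,b,c ∈ W_A, then a ≡_∞ b; (iv) the relation <_L on A_∞ is irreflexive: for no word a ∈ W_A do there exist k ≥ 1 and words c_1,…,c_k with ((a·c_1)·c_2)···c_k ≡_∞ a; (v) if a <_L b in A_∞ (i.e. ((a·c_1)·c_2)···c_k ≡_∞ b for some c_1,…,c_k), then [a]_n < [b]_n for all but finitely many n; (vi) for every word a ∈ W_A, there is an n with [a]_n ≠ 0; (vii) for every k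 ≥ 0, there is an n with [u_k]_n ≠ 0; (viii) for every k ≥ 1, there is an n with [1·k]_n ≠ 0, where k denotes the word representing the integer k. -/
/-- The inclusion of `W_A` into `W_P`. -/
def WA.toWP : WA → WP
  | WA.one => WP.one
  | WA.mul a b => WP.mul a.toWP b.toWP

/-- `[a]_n`: the evaluation of a word `a ∈ W_P` in `P_n = ℤ/2^nℤ`, interpreting
the generator as `1`, `·` as `*_n` (`op n`) and `∘` as `∘_n` (`cmp n`). -/
def evalP (op cmp : ∀ n : ℕ, ZMod (2 ^ n) → ZMod (2 ^ n) → ZMod (2 ^ n))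
    (n : ℕ) : WP → ZMod (2 ^ n)
  | WP.one => 1
  | WP.mul a b => op n (evalP op cmp n a) (evalP op cmp n b)
  | WP.comp a b => cmp n (evalP op cmp n a) (evalP op cmp n b)

/-- The relation `≡_∞`: `a ≡_∞ b` iff `[a]_n = [b]_n` for all `n ≥ 0`. -/
def EqInf (op cmp : ∀ n : ℕ, ZMod (2 ^ n) → ZMod (2 ^ n) → ZMod (2 ^ n))
    (a b : WP) : Prop :=
  ∀ n : ℕ, evalP op cmp n a = evalP op cmp n b

/-- The herringbones: `u_0 = 1`, `u_{k+1} = 1·u_k`. -/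
def herring : ℕ → WA
  | 0 => WA.one
  | k + 1 => WA.mul WA.one (herring k)

/-- The word representing the positive integer `k` (for `k ≥ 1`): the integer `1`
is the generator, and the integer `k+1` is the word `k·1`. -/
def posWord : ℕ → WA
  | 0 => WA.one
  | 1 => WA.one
  | (k + 2) => WA.mul (posWord (k + 1)) WA.one

/-! ### Laver tables -/

/-- A left distributive operation on `ℤ/N` such that `a * 1 = a + 1`. -/
structure IsLaverTable {N : ℕ} (op : ZMod N → ZMod N → ZMod N) : Prop where
  left_distrib : ∀ a b c, op a (op b c) = op (op a b) (op a c)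
  op_one : ∀ a, op a 1 = a + 1

theorem ALSigma.left_distrib {α : Type*} {mul comp : α → α → α} (h : ALSigma mul comp)
    (a b c : α) : mul a (mul b c) = mul (mul a b) (mul a c) := by
  obtain ⟨-, h₂, -, h₄⟩ := h
  rw [← h₂, h₄, h₂]

theorem ZMod.induction_from_one {N : ℕ} [NeZero N] {P : ZMod N → Prop} (one : P 1)
    (succ : ∀ b, P b → P (b + 1)) (b : ZMod N) : P b := by
  have h : ∀ k : ℕ, P ((k : ZMod N) + 1) := by
    intro k
    induction k with
    | zero => simpa using one
    | succ k ih => simpa using succ _ ih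
  simpa using h (b - 1).val

theorem ZMod.val_lt_val_add_one {N : ℕ} [NeZero N] (a : ZMod N) (h : a + 1 ≠ 0) :
    a.val < (a + 1).val := by
  have hN : 1 < N := by
    have := NeZero.ne N
    by_contra hN
    obtain rfl : N = 1 := by omega
    exact h (Subsingleton.elim _ _)
  have : Fact (1 < N) := ⟨hN⟩
  rcases lt_or_ge (a.val + 1) N with h' | h'
  · rw [ZMod.val_add_of_lt (by rwa [ZMod.val_one]), ZMod.val_one]
    omega
  · have := a.val_lt
    refine absurd ?_ h
    have h1 : a.val + 1 = N := by omega
    have := congrArg (Nat.cast : ℕ → ZMod N) h1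
    simpa using this

theorem ZMod.exists_nsmul_eq_two_pow {n m : ℕ} (x : ZMod (2 ^ n)) (hx : ¬ 2 ^ m ∣ x.val) :
    ∃ k : ℕ, k • x = ((2 ^ m : ℕ) : ZMod (2 ^ n)) := by
  obtain ⟨v, -, hv⟩ := (Nat.dvd_prime_pow Nat.prime_two).1 (Nat.gcd_dvd_right x.val (2 ^ n))
  have hvm : v ≤ m := by
    by_contra! h
    exact hx ((pow_dvd_pow 2 h.le).trans (hv ▸ Nat.gcd_dvd_left _ _))
  have hbez := Nat.gcd_eq_gcd_ab x.val (2 ^ n)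
  rw [hv] at hbez
  have h : ((2 ^ v : ℕ) : ZMod (2 ^ n)) = x * ((x.val.gcdA (2 ^ n) : ℤ) : ZMod (2 ^ n)) := by
    have := congrArg (Int.cast : ℤ → ZMod (2 ^ n)) hbez
    have h0 : ((2 : ZMod (2 ^ n)) ^ n) = 0 := by
      exact_mod_cast ZMod.natCast_self (2 ^ n)
    simpa [h0] using this
  refine ⟨((x.val.gcdA (2 ^ n) : ZMod (2 ^ n)) * ((2 ^ (m - v) : ℕ) : ZMod (2 ^ n))).val, ?_⟩
  rw [nsmul_eq_mul, ZMod.natCast_zmod_val, mul_right_comm, mul_comm _ x, ← h, ← Nat.cast_mul,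
    ← pow_add, Nat.add_sub_cancel' hvm]

namespace IsLaverTable

variable {N : ℕ} {op : ZMod N → ZMod N → ZMod N}

theorem op_add_one (h : IsLaverTable op) (a b : ZMod N) :
    op a (b + 1) = op (op a b) (a + 1) := by
  rw [← h.op_one, h.left_distrib, h.op_one]

variable [NeZero N]

theorem zero_op (h : IsLaverTable op) (b : ZMod N) : op 0 b = b := by
  induction b using ZMod.induction_from_one with
  | one => simp [h.op_one]
  | succ b ih => rw [h.op_add_one, ih, zero_add, h.op_one]

theorem neg_one_op (h : IsLaverTable op) (b : ZMod N) : op (-1) b = 0 := by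
  induction b using ZMod.induction_from_one with
  | one => simp [h.op_one]
  | succ b ih => rw [h.op_add_one, ih, h.zero_op, neg_add_cancel]

/-- Products lie strictly above their left factor, where `0` counts as the top element. -/
theorem val_lt_val_op (h : IsLaverTable op) (a b : ZMod N) (hab : op a b ≠ 0) :
    a.val < (op a b).val := by
  induction hr : N - a.val using Nat.strong_induction_on generalizing a b with
  | _ r ih =>
    subst hr
    rcases eq_or_ne a 0 with rfl | ha
    · rw [h.zero_op] at hab ⊢
      rw [ZMod.val_zero]
      exact Nat.pos_of_ne_zero (by rwa [Ne, ZMod.val_eq_zero])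
    · induction b using ZMod.induction_from_one with
      | one =>
        rw [h.op_one] at hab ⊢
        exact ZMod.val_lt_val_add_one a hab
      | succ b ihb =>
        rw [h.op_add_one] at hab ⊢
        rcases eq_or_ne (op a b) 0 with h0 | h0
        · rw [h0, h.zero_op] at hab ⊢
          exact ZMod.val_lt_val_add_one a hab
        · have h1 := ihb h0
          have := a.val_lt
          exact h1.trans (ih _ (by omega) _ _ hab rfl)

theorem op_add_eq_op_add (h : IsLaverTable op) {a b c : ZMod N} (hbc : op a b = op a c)
    (j : ZMod N) : op a (b + j) = op a (c + j) := by
  induction j using ZMod.induction_from_one with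
  | one => rw [h.op_add_one a b, h.op_add_one a c, hbc]
  | succ j ih => rw [← add_assoc, ← add_assoc, h.op_add_one a (b + j), h.op_add_one a (c + j), ih]

theorem op_zero (h : IsLaverTable op) (a : ZMod N) : op a 0 = 0 := by
  obtain ⟨b, hb⟩ := Finite.exists_max fun b => (op a b).val
  have h0 : op a b = 0 ∨ op a (b + 1) = 0 := by
    by_contra! hne
    have hlt := h.val_lt_val_op (op a b) (a + 1) (by rw [← h.op_add_one]; exact hne.2)
    rw [← h.op_add_one] at hlt
    exact absurd (hb (b + 1)) (not_le.2 hlt)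
  obtain ⟨c, hc⟩ : ∃ c, op a c = 0 := h0.elim (fun h => ⟨_, h⟩) fun h => ⟨_, h⟩
  have h1 : op a (c + 1) = op a 1 := by
    rw [h.op_add_one, hc, h.zero_op, h.op_one]
  have h2 := h.op_add_eq_op_add h1 (-1)
  rw [add_neg_cancel_right, add_neg_cancel, hc] at h2
  exact h2.symm

theorem op_sub_eq_zero (h : IsLaverTable op) {a b c : ZMod N} (hbc : op a b = op a c) :
    op a (b - c) = 0 := by
  have := h.op_add_eq_op_add hbc (-c)
  rwa [← sub_eq_add_neg, ← sub_eq_add_neg, sub_self, h.op_zero] at this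

theorem op_nsmul_eq_zero (h : IsLaverTable op) {a x : ZMod N} (hx : op a x = 0) (k : ℕ) :
    op a (k • x) = 0 := by
  induction k with
  | zero => rw [zero_smul, h.op_zero]
  | succ k ih =>
    have := h.op_add_eq_op_add (hx.trans (h.op_zero a).symm) (k • x)
    rw [succ_nsmul', this, zero_add, ih]

/-- Only `0` is fixed by left multiplication by `1`. -/
theorem eq_zero_of_one_op (h : IsLaverTable op) {x : ZMod N} (hx : op 1 x = x) : x = 0 := by
  have hfix : ∀ a, op a x = x := by
    intro a
    induction a using ZMod.induction_from_one with
    | one => exact hx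
    | succ a ih =>
      have := h.left_distrib a 1 x
      rwa [hx, ih, h.op_one, eq_comm] at this
  rw [← hfix (-1), h.neg_one_op]

/-- Reduction modulo a divisor is a homomorphism of Laver tables. -/
theorem castHom_op (h : IsLaverTable op) {M : ℕ} [NeZero M] {op' : ZMod M → ZMod M → ZMod M}
    (h' : IsLaverTable op') (hMN : M ∣ N) (a b : ZMod N) :
    ZMod.castHom hMN (ZMod M) (op a b) =
      op' (ZMod.castHom hMN (ZMod M) a) (ZMod.castHom hMN (ZMod M) b) := by
  rcases eq_or_ne a 0 with rfl | ha
  · rw [h.zero_op, map_zero, h'.zero_op]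
  induction hr : N - a.val using Nat.strong_induction_on generalizing a b with
  | _ r ih =>
    subst hr
    induction b using ZMod.induction_from_one with
    | one => rw [h.op_one, map_add, map_one, h'.op_one]
    | succ b ihb =>
      rw [h.op_add_one, map_add, map_one, h'.op_add_one, ← ihb]
      rcases eq_or_ne (op a b) 0 with h0 | h0
      · rw [h0, h.zero_op, map_zero, h'.zero_op, map_add, map_one]
      · have h1 := h.val_lt_val_op a b h0
        have := a.val_lt
        rw [ih _ (by omega) _ _ h0 rfl, map_add, map_one]

end IsLaverTable

/-! ### Confluence of left distributivity -/

/-- `LDExp a b`: the word `b` results from `a` by applying left distributivity from left to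
right only. -/
inductive LDExp : WA → WA → Prop
  | refl (a : WA) : LDExp a a
  | trans {a b c : WA} : LDExp a b → LDExp b c → LDExp a c
  | congr {a a' b b' : WA} : LDExp a a' → LDExp b b' → LDExp (a.mul b) (a'.mul b')
  | ld (a b c : WA) : LDExp (a.mul (b.mul c)) ((a.mul b).mul (a.mul c))

theorem LDExp.ldEq {a b : WA} (h : LDExp a b) : LDEq a b := by
  induction h with
  | refl a => exact .refl a
  | trans _ _ ih₁ ih₂ => exact .trans ih₁ ih₂
  | congr _ _ ih₁ ih₂ => exact .congr ih₁ ih₂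
  | ld a b c => exact .ld a b c

namespace WA

/-- The word obtained by distributing `t` over all leaves of a word. -/
def distribute (t : WA) : WA → WA
  | one => t.mul one
  | mul x y => (distribute t x).mul (distribute t y)

/-- Dehornoy's common expansion of all one-step expansions of a word. -/
def expand : WA → WA
  | one => one
  | mul x y => distribute (expand x) (expand y)

theorem ldExp_distribute (t s : WA) : LDExp (t.mul s) (distribute t s) := by
  induction s with
  | one => exact .refl _
  | mul x y ihx ihy => exact (LDExp.ld t x y).trans (.congr ihx ihy)

end WA

open WA

theorem LDExp.distribute {t t' s s' : WA} (ht : LDExp t t') (hs : LDExp s s') :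
    LDExp (distribute t s) (distribute t' s') := by
  have h₁ : LDExp (WA.distribute t s) (WA.distribute t' s) := by
    clear hs
    induction s with
    | one => exact .congr ht (.refl _)
    | mul x y ihx ihy => exact .congr ihx ihy
  refine h₁.trans ?_
  clear h₁ ht
  induction hs with
  | refl a => exact .refl _
  | trans _ _ ih₁ ih₂ => exact .trans ih₁ ih₂
  | congr _ _ ih₁ ih₂ => exact .congr ih₁ ih₂
  | ld a b c => exact .ld _ _ _

namespace WA

theorem mul_expand_ldExp (x y : WA) : LDExp (x.expand.mul y.expand) (x.mul y).expand :=
  ldExp_distribute _ _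

theorem ldExp_expand (t : WA) : LDExp t t.expand := by
  induction t with
  | one => exact .refl _
  | mul x y ihx ihy => exact (LDExp.congr ihx ihy).trans (mul_expand_ldExp x y)

theorem distribute_distribute_ldExp (a b c : WA) :
    LDExp (distribute a (distribute b c)) (distribute (distribute a b) (distribute a c)) := by
  induction c with
  | one => exact ldExp_distribute (distribute a b) (a.mul one)
  | mul x y ihx ihy => exact .congr ihx ihy

theorem ldExp_expand_of_ld (a b c : WA) :
    LDExp ((a.mul b).mul (a.mul c)) (a.mul (b.mul c)).expand :=
  (LDExp.congr (ldExp_expand (a.mul b)) (ldExp_expand (a.mul c))).trans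
    ((LDExp.refl a.expand).distribute (mul_expand_ldExp b c))

end WA

theorem LDExp.expand {a b : WA} (h : LDExp a b) : LDExp a.expand b.expand := by
  induction h with
  | refl a => exact .refl _
  | trans _ _ ih₁ ih₂ => exact .trans ih₁ ih₂
  | congr _ _ ih₁ ih₂ => exact ih₁.distribute ih₂
  | ld a b c => exact distribute_distribute_ldExp _ _ _

theorem LDExp.iterate_expand {a b : WA} (h : LDExp a b) (k : ℕ) :
    LDExp (WA.expand^[k] a) (WA.expand^[k] b) := by
  induction k with
  | zero => exact h
  | succ k ih => simpa only [Function.iterate_succ_apply'] using ih.expand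

namespace WA

theorem iterate_expand_ldExp_of_le (a : WA) {k m : ℕ} (h : k ≤ m) :
    LDExp (expand^[k] a) (expand^[m] a) := by
  induction h with
  | refl => exact .refl _
  | step _ ih =>
    rw [Function.iterate_succ_apply']
    exact ih.trans (ldExp_expand _)

theorem mul_iterate_expand_ldExp (a b : WA) (k : ℕ) :
    LDExp ((expand^[k] a).mul (expand^[k] b)) (expand^[k] (a.mul b)) := by
  induction k with
  | zero => exact .refl _
  | succ k ih =>
    simp only [Function.iterate_succ_apply']
    exact (mul_expand_ldExp _ _).trans ih.expand

end WA

theorem LDExp.exists_ldExp_iterate_expand {a b : WA} (h : LDExp a b) :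
    ∃ k, LDExp b (WA.expand^[k] a) := by
  induction h with
  | refl a => exact ⟨0, .refl a⟩
  | trans _ _ ih₁ ih₂ =>
    obtain ⟨k, hk⟩ := ih₁
    obtain ⟨m, hm⟩ := ih₂
    refine ⟨m + k, hm.trans ?_⟩
    rw [Function.iterate_add_apply]
    exact hk.iterate_expand m
  | @congr a a' b b' _ _ ih₁ ih₂ =>
    obtain ⟨k, hk⟩ := ih₁
    obtain ⟨m, hm⟩ := ih₂
    exact ⟨max k m,
      (LDExp.congr (hk.trans (iterate_expand_ldExp_of_le a (le_max_left k m)))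
        (hm.trans (iterate_expand_ldExp_of_le b (le_max_right k m)))).trans
        (mul_iterate_expand_ldExp a b _)⟩
  | ld a b c => exact ⟨1, ldExp_expand_of_ld a b c⟩

/-- LD-equivalent words have a common LD-expansion. -/
theorem LDEq.exists_common_ldExp {a b : WA} (h : LDEq a b) : ∃ c, LDExp a c ∧ LDExp b c := by
  induction h with
  | refl a => exact ⟨a, .refl a, .refl a⟩
  | symm _ ih =>
    obtain ⟨c, h₁, h₂⟩ := ih
    exact ⟨c, h₂, h₁⟩
  | @trans a b c _ _ ih₁ ih₂ =>
    obtain ⟨x, hax, hbx⟩ := ih₁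
    obtain ⟨y, hby, hcy⟩ := ih₂
    obtain ⟨k, hk⟩ := hbx.exists_ldExp_iterate_expand
    obtain ⟨m, hm⟩ := hby.exists_ldExp_iterate_expand
    exact ⟨WA.expand^[max k m] b,
      hax.trans (hk.trans (iterate_expand_ldExp_of_le b (le_max_left k m))),
      hcy.trans (hm.trans (iterate_expand_ldExp_of_le b (le_max_right k m)))⟩
  | congr _ _ ih₁ ih₂ =>
    obtain ⟨x, h₁, h₂⟩ := ih₁
    obtain ⟨y, h₃, h₄⟩ := ih₂
    exact ⟨x.mul y, .congr h₁ h₃, .congr h₂ h₄⟩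
  | ld a b c => exact ⟨_, .ld a b c, .refl _⟩

/-! ### Comparability of words under left division -/

/-- `LeftSubword a t`: the word `t` has the form `((a·c₁)·c₂)···cₖ` with `k ≥ 0`. -/
inductive LeftSubword (a : WA) : WA → Prop
  | refl : LeftSubword a a
  | mul {x : WA} (y : WA) : LeftSubword a x → LeftSubword a (x.mul y)

namespace LeftSubword

theorem exists_foldl {a t : WA} (h : LeftSubword a t) : ∃ l : List WA, l.foldl WA.mul a = t := by
  induction h with
  | refl => exact ⟨[], rfl⟩
  | mul y _ ih =>
    obtain ⟨l, hl⟩ := ih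
    exact ⟨l ++ [y], by simp [hl]⟩

theorem total {a b t : WA} (ha : LeftSubword a t) (hb : LeftSubword b t) :
    LeftSubword a b ∨ LeftSubword b a := by
  induction ha with
  | refl => exact .inr hb
  | mul y h ih =>
    cases hb with
    | refl => exact .inl (.mul y h)
    | mul _ hb => exact ih hb

theorem exists_of_ldExp {a t t' : WA} (ht : LDExp t t') (ha : LeftSubword a t) :
    ∃ a', LDExp a a' ∧ LeftSubword a' t' := by
  induction ht generalizing a with
  | refl => exact ⟨a, .refl a, ha⟩
  | trans _ _ ih₁ ih₂ =>
    obtain ⟨x, hx, hx'⟩ := ih₁ ha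
    obtain ⟨y, hy, hy'⟩ := ih₂ hx'
    exact ⟨y, hx.trans hy, hy'⟩
  | congr h₁ h₂ ih₁ _ =>
    cases ha with
    | refl => exact ⟨_, .congr h₁ h₂, .refl⟩
    | mul _ ha =>
      obtain ⟨x, hx, hx'⟩ := ih₁ ha
      exact ⟨x, hx, .mul _ hx'⟩
  | ld x y z =>
    cases ha with
    | refl => exact ⟨_, .ld x y z, .refl⟩
    | mul _ ha => exact ⟨a, .refl a, .mul _ (.mul _ ha)⟩

end LeftSubword

/-- Long herringbones absorb any given word on their left. -/
theorem exists_mul_herring_ldEq (a : WA) :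
    ∃ m, ∀ k ≥ m, LDEq (a.mul (herring k)) (herring (k + 1)) := by
  induction a with
  | one => exact ⟨0, fun k _ => .refl _⟩
  | mul x y ihx ihy =>
    obtain ⟨m, hm⟩ := ihx
    obtain ⟨p, hp⟩ := ihy
    refine ⟨max m p + 1, fun k hk => ?_⟩
    obtain ⟨j, rfl⟩ : ∃ j, k = j + 1 := ⟨k - 1, by omega⟩
    have h₁ : LDEq ((x.mul y).mul (herring (j + 1))) ((x.mul y).mul (x.mul (herring j))) :=
      .congr (.refl _) (hm j (by omega)).symm
    have h₂ : LDEq (x.mul (y.mul (herring j))) (x.mul (herring (j + 1))) :=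
      .congr (.refl _) (hp j (by omega))
    exact h₁.trans ((LDEq.ld _ _ _).symm.trans (h₂.trans (hm (j + 1) (by omega))))

/-- Any two words are comparable under iterated left division, up to LD-equivalence. -/
theorem exists_ldEq_leftSubword (a b : WA) :
    ∃ a' b', LDEq a a' ∧ LDEq b b' ∧ (LeftSubword a' b' ∨ LeftSubword b' a') := by
  obtain ⟨m, hm⟩ := exists_mul_herring_ldEq a
  obtain ⟨p, hp⟩ := exists_mul_herring_ldEq b
  obtain ⟨c, hac, hbc⟩ := ((hm (max m p) (le_max_left m p)).trans
    (hp (max m p) (le_max_right m p)).symm).exists_common_ldExp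
  obtain ⟨a', haa', ha'⟩ := LeftSubword.exists_of_ldExp hac (.mul _ .refl)
  obtain ⟨b', hbb', hb'⟩ := LeftSubword.exists_of_ldExp hbc (.mul _ .refl)
  exact ⟨a', b', haa'.ldEq, hbb'.ldEq, ha'.total hb'⟩

/-- The length of the rightmost branch of a word. -/
def WA.rightDepth : WA → ℕ
  | one => 0
  | mul _ y => y.rightDepth + 1

theorem LDEq.rightDepth_eq {a b : WA} (h : LDEq a b) : a.rightDepth = b.rightDepth := by
  induction h with
  | refl => rfl
  | symm _ ih => exact ih.symm
  | trans _ _ ih₁ ih₂ => exact ih₁.trans ih₂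
  | congr _ _ _ ih => exact congrArg (· + 1) ih
  | ld => rfl

/-! ### The free algebra with composition as lists of words -/

/-- The congruence on lists of words (regarded as compositions) generated by
left distributivity and `a∘b = (a·b)∘a`. -/
inductive ListEq : List WA → List WA → Prop
  | nil : ListEq [] []
  | cons {a b : WA} {l l' : List WA} : LDEq a b → ListEq l l' → ListEq (a :: l) (b :: l')
  | swap (a b : WA) (l : List WA) : ListEq (a :: b :: l) (a.mul b :: a :: l)
  | symm {l l' : List WA} : ListEq l l' → ListEq l' l
  | trans {l₁ l₂ l₃ : List WA} : ListEq l₁ l₂ → ListEq l₂ l₃ → ListEq l₁ l₃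

/-- The factors of a word of `W_P` written as a composition of words of `W_A`. -/
def WP.factors : WP → List WA
  | one => [WA.one]
  | mul p q => q.factors.map fun x => p.factors.foldr WA.mul x
  | comp p q => p.factors ++ q.factors

/-- The composition of a nonempty list of words; the value at `[]` is irrelevant. -/
def composition : List WA → WP
  | [] => WP.one
  | [a] => a.toWP
  | a :: b :: l => a.toWP.comp (composition (b :: l))

/-- The words `a₁, …, aₖ` such that a given word is `a₁·(a₂·(⋯(aₖ·1)))`. -/
def WA.spine_s18 : WA → List WA
  | one => []
  | mul a b => a :: b.spine_s18

namespace ListEq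

theorem refl (l : List WA) : ListEq l l := by
  induction l with
  | nil => exact .nil
  | cons a l ih => exact .cons (.refl a) ih

theorem append {l₁ l₁' l₂ l₂' : List WA} (h₁ : ListEq l₁ l₁') (h₂ : ListEq l₂ l₂') :
    ListEq (l₁ ++ l₂) (l₁' ++ l₂') := by
  have h : ListEq (l₁ ++ l₂) (l₁ ++ l₂') := by
    clear h₁
    induction l₁ with
    | nil => exact h₂
    | cons a l ih => exact .cons (.refl a) ih
  refine h.trans ?_
  clear h h₂
  induction h₁ with
  | nil => exact refl _
  | cons h _ ih => exact .cons h ih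
  | swap a b l => exact .swap a b _
  | symm _ ih => exact .symm ih
  | trans _ _ ih₁ ih₂ => exact .trans ih₁ ih₂

theorem length_eq {l l' : List WA} (h : ListEq l l') : l.length = l'.length := by
  induction h with
  | nil => rfl
  | cons _ _ ih => exact congrArg (· + 1) ih
  | swap => rfl
  | symm _ ih => exact ih.symm
  | trans _ _ ih₁ ih₂ => exact ih₁.trans ih₂

theorem ldEq_of_singleton {a b : WA} (h : ListEq [a] [b]) : LDEq a b := by
  suffices ∀ l l', ListEq l l' → ∀ a b, l = [a] → l' = [b] → LDEq a b from
    this _ _ h a b rfl rfl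
  clear h a b
  intro l l' h
  induction h with
  | nil => simp
  | cons h _ _ =>
    intro a b ha hb
    obtain ⟨rfl, -⟩ := List.cons.inj ha
    obtain ⟨rfl, -⟩ := List.cons.inj hb
    exact h
  | swap => simp
  | symm _ ih => exact fun a b ha hb => (ih b a hb ha).symm
  | trans h₁ _ ih₁ ih₂ =>
    rintro a b rfl rfl
    obtain ⟨c, hc⟩ := List.length_eq_one_iff.1 h₁.length_eq.symm
    exact (ih₁ a c rfl hc).trans (ih₂ c b hc rfl)

end ListEq

theorem LDEq.foldr_mul {x y : WA} (h : LDEq x y) (l : List WA) :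
    LDEq (l.foldr WA.mul x) (l.foldr WA.mul y) := by
  induction l with
  | nil => exact h
  | cons a l ih => exact .congr (.refl a) ih

theorem ListEq.foldr_mul {l l' : List WA} (h : ListEq l l') (x : WA) :
    LDEq (l.foldr WA.mul x) (l'.foldr WA.mul x) := by
  induction h with
  | nil => exact .refl x
  | cons h _ ih => exact .congr h ih
  | swap a b l => exact .ld _ _ _
  | symm _ ih => exact ih.symm
  | trans _ _ ih₁ ih₂ => exact ih₁.trans ih₂

theorem foldr_mul_mul (l : List WA) (x y : WA) :
    LDEq (l.foldr WA.mul (x.mul y)) ((l.foldr WA.mul x).mul (l.foldr WA.mul y)) := by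
  induction l with
  | nil => exact .refl _
  | cons a l ih => exact (LDEq.congr (.refl a) ih).trans (.ld _ _ _)

namespace ListEq

theorem map_foldr_left {l l' : List WA} (h : ListEq l l') (q : List WA) :
    ListEq (q.map fun x => l.foldr WA.mul x) (q.map fun x => l'.foldr WA.mul x) := by
  induction q with
  | nil => exact .nil
  | cons a q ih => exact .cons (h.foldr_mul a) ih

theorem map_foldr_right {q q' : List WA} (h : ListEq q q') (l : List WA) :
    ListEq (q.map fun x => l.foldr WA.mul x) (q'.map fun x => l.foldr WA.mul x) := by
  induction h with
  | nil => exact .nil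
  | cons h _ ih => exact .cons (h.foldr_mul l) ih
  | swap a b q =>
    exact (ListEq.swap _ _ _).trans (.cons (foldr_mul_mul l a b).symm (refl _))
  | symm _ ih => exact ih.symm
  | trans _ _ ih₁ ih₂ => exact ih₁.trans ih₂

theorem cons_append (a : WA) (q : List WA) :
    ListEq (a :: q) ((q.map fun x => a.mul x) ++ [a]) := by
  induction q with
  | nil => exact refl _
  | cons b q ih => exact (ListEq.swap a b q).trans (.cons (.refl _) ih)

theorem append_comm (p q : List WA) :
    ListEq (p ++ q) ((q.map fun x => p.foldr WA.mul x) ++ p) := by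
  induction p with
  | nil => simpa using refl q
  | cons a p ih =>
    refine (ListEq.cons (.refl a) ih).trans ?_
    have := (cons_append a (q.map fun x => p.foldr WA.mul x)).append (refl p)
    simpa [Function.comp_def] using this

end ListEq

theorem PEq.listEq_factors {a b : WP} (h : PEq a b) : ListEq a.factors b.factors := by
  induction h with
  | refl => exact .refl _
  | symm _ ih => exact ih.symm
  | trans _ _ ih₁ ih₂ => exact ih₁.trans ih₂
  | congr_mul _ _ ih₁ ih₂ => exact (ih₁.map_foldr_left _).trans (ih₂.map_foldr_right _)
  | congr_comp _ _ ih₁ ih₂ => exact ih₁.append ih₂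
  | assoc a b c => simpa [WP.factors] using ListEq.refl _
  | comp_mul a b c => simpa [WP.factors, Function.comp_def] using ListEq.refl _
  | mul_comp a b c => simpa [WP.factors] using ListEq.refl _
  | comp_eq a b => exact ListEq.append_comm _ _

theorem WA.factors_toWP (a : WA) : a.toWP.factors = [a] := by
  induction a with
  | one => rfl
  | mul x y ihx ihy => simp [WA.toWP, WP.factors, ihx, ihy]

theorem LDEq.pEq {a b : WA} (h : LDEq a b) : PEq a.toWP b.toWP := by
  induction h with
  | refl => exact .refl _
  | symm _ ih => exact ih.symm
  | trans _ _ ih₁ ih₂ => exact ih₁.trans ih₂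
  | congr _ _ ih₁ ih₂ => exact .congr_mul ih₁ ih₂
  | ld a b c =>
    exact (PEq.comp_mul _ _ _).symm.trans
      ((PEq.congr_mul (.comp_eq _ _) (.refl _)).trans (.comp_mul _ _ _))

/-- The free left distributive algebra embeds in the free algebra with composition. -/
theorem PEq.ldEq {a b : WA} (h : PEq a.toWP b.toWP) : LDEq a b := by
  have := h.listEq_factors
  rw [WA.factors_toWP, WA.factors_toWP] at this
  exact this.ldEq_of_singleton

theorem ListEq.pEq_composition {l l' : List WA} (h : ListEq l l') :
    PEq (composition l) (composition l') := by
  induction h with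
  | nil => exact .refl _
  | @cons a b l l' h h' ih =>
    have hl := h'.length_eq
    match l, l', hl with
    | [], [], _ => exact h.pEq
    | _ :: _, _ :: _, _ => exact .congr_comp h.pEq ih
  | swap a b l =>
    cases l with
    | nil => exact .comp_eq _ _
    | cons c l =>
      exact (PEq.assoc _ _ _).trans
        ((PEq.congr_comp (.comp_eq _ _) (.refl _)).trans (PEq.assoc _ _ _).symm)
  | symm _ ih => exact ih.symm
  | trans _ _ ih₁ ih₂ => exact ih₁.trans ih₂

theorem composition_mul_pEq {l : List WA} (hl : l ≠ []) (x : WA) :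
    PEq ((composition l).mul x.toWP) (l.foldr WA.mul x).toWP := by
  induction l with
  | nil => exact absurd rfl hl
  | cons a l ih =>
    cases l with
    | nil => exact .refl _
    | cons b l =>
      exact (PEq.comp_mul _ _ _).trans (.congr_mul (.refl _) (ih (List.cons_ne_nil b l)))

theorem composition_append_pEq {p q : List WA} (hp : p ≠ []) (hq : q ≠ []) :
    PEq ((composition p).comp (composition q)) (composition (p ++ q)) := by
  induction p with
  | nil => exact absurd rfl hp
  | cons a p ih =>
    cases p with
    | nil =>
      cases q with
      | nil => exact absurd rfl hq
      | cons b q => exact .refl _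
    | cons b p =>
      exact (PEq.assoc _ _ _).symm.trans (.congr_comp (.refl _) (ih (List.cons_ne_nil b p)))

theorem composition_map_pEq {p q : List WA} (hp : p ≠ []) (hq : q ≠ []) :
    PEq ((composition p).mul (composition q))
      (composition (q.map fun x => p.foldr WA.mul x)) := by
  induction q with
  | nil => exact absurd rfl hq
  | cons a q ih =>
    cases q with
    | nil => exact composition_mul_pEq hp a
    | cons b q =>
      exact (PEq.mul_comp _ _ _).trans
        (.congr_comp (composition_mul_pEq hp a) (ih (List.cons_ne_nil b q)))

theorem WP.factors_ne_nil (a : WP) : a.factors ≠ [] := by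
  induction a with
  | one => simp [factors]
  | mul p q _ ihq => simpa [factors] using ihq
  | comp p q ihp _ => simp [factors, ihp]

theorem WP.pEq_composition_factors (a : WP) : PEq a (composition a.factors) := by
  induction a with
  | one => exact .refl _
  | mul p q ihp ihq =>
    exact (PEq.congr_mul ihp ihq).trans
      (composition_map_pEq p.factors_ne_nil q.factors_ne_nil)
  | comp p q ihp ihq =>
    exact (PEq.congr_comp ihp ihq).trans
      (composition_append_pEq p.factors_ne_nil q.factors_ne_nil)

theorem WP.mul_one_pEq (a : WP) :
    PEq (a.mul WP.one) (a.factors.foldr WA.mul WA.one).toWP :=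
  (PEq.congr_mul a.pEq_composition_factors (.refl _)).trans
    (composition_mul_pEq a.factors_ne_nil WA.one)

theorem LDEq.listEq_spine {a b : WA} (h : LDEq a b) : ListEq a.spine_s18 b.spine_s18 := by
  induction h with
  | refl => exact .refl _
  | symm _ ih => exact ih.symm
  | trans _ _ ih₁ ih₂ => exact ih₁.trans ih₂
  | congr h _ _ ih => exact .cons h ih
  | ld a b c => exact .swap _ _ _

theorem WA.spine_foldr_mul_one (l : List WA) : (l.foldr WA.mul WA.one).spine_s18 = l := by
  induction l with
  | nil => rfl
  | cons a l ih => exact congrArg (a :: ·) ih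

/-- In the free algebra with composition, `a` is determined by `a·1`. -/
theorem PEq.of_mul_one {a b : WP}
    (h : LDEq (a.factors.foldr WA.mul WA.one) (b.factors.foldr WA.mul WA.one)) : PEq a b := by
  have := h.listEq_spine
  rw [WA.spine_foldr_mul_one, WA.spine_foldr_mul_one] at this
  exact a.pEq_composition_factors.trans
    (this.pEq_composition.trans b.pEq_composition_factors.symm)

/-! ### Evaluation of words in Laver tables -/

section Eval

variable {op cmp : ∀ n : ℕ, ZMod (2 ^ n) → ZMod (2 ^ n) → ZMod (2 ^ n)}

theorem PEq.eqInf (hlaws : ∀ n, ALSigma (op n) (cmp n)) {a b : WP} (h : PEq a b) :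
    EqInf op cmp a b := by
  intro n
  obtain ⟨h₁, h₂, h₃, h₄⟩ := hlaws n
  induction h with
  | refl => rfl
  | symm _ ih => exact ih.symm
  | trans _ _ ih₁ ih₂ => exact ih₁.trans ih₂
  | congr_mul _ _ ih₁ ih₂ => exact congrArg₂ (op n) ih₁ ih₂
  | congr_comp _ _ ih₁ ih₂ => exact congrArg₂ (cmp n) ih₁ ih₂
  | assoc => exact h₁ _ _ _
  | comp_mul => exact h₂ _ _ _
  | mul_comp => exact h₃ _ _ _
  | comp_eq => exact h₄ _ _

theorem evalP_posWord (hop : ∀ n, IsLaverTable (op n)) (n k : ℕ) (hk : 1 ≤ k) :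
    evalP op cmp n (posWord k).toWP = k := by
  induction k, hk using Nat.le_induction with
  | base => simp [posWord, WA.toWP, evalP]
  | succ k hk ih =>
    obtain ⟨j, rfl⟩ : ∃ j, k = j + 1 := ⟨k - 1, by omega⟩
    change op n (evalP op cmp n (posWord (j + 1)).toWP) 1 = _
    rw [ih, (hop n).op_one, Nat.cast_succ (j + 1)]

theorem castHom_evalP (hop : ∀ n, IsLaverTable (op n)) {n m : ℕ} (hnm : n ≤ m) (a : WA) :
    ZMod.castHom (pow_dvd_pow 2 hnm) (ZMod (2 ^ n)) (evalP op cmp m a.toWP) =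
      evalP op cmp n a.toWP := by
  induction a with
  | one => exact map_one _
  | mul x y ihx ihy =>
    change ZMod.castHom _ _ (op m _ _) = op n _ _
    rw [(hop m).castHom_op (hop n), ihx, ihy]

theorem evalP_ne_zero_of_le (hop : ∀ n, IsLaverTable (op n)) {n m : ℕ} (hnm : n ≤ m) {a : WA}
    (ha : evalP op cmp n a.toWP ≠ 0) : evalP op cmp m a.toWP ≠ 0 := by
  intro h
  rw [← castHom_evalP hop hnm, h, map_zero] at ha
  exact ha rfl

/-- If left multiplication by `c` annihilates a nonzero coherent sequence, then it annihilates
some power of two in all Laver tables. -/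
theorem evalP_mul_posWord_eq_zero (hop : ∀ n, IsLaverTable (op n)) (c : WA)
    (x : ∀ m, ZMod (2 ^ m))
    (hx : ∀ n m (hnm : n ≤ m), ZMod.castHom (pow_dvd_pow 2 hnm) (ZMod (2 ^ n)) (x m) = x n)
    (hcx : ∀ m, op m (evalP op cmp m c.toWP) (x m) = 0) {n : ℕ} (hn : x n ≠ 0) (m : ℕ) :
    evalP op cmp m (c.mul (posWord (2 ^ n))).toWP = 0 := by
  change op m _ (evalP op cmp m (posWord (2 ^ n)).toWP) = 0
  rw [evalP_posWord hop m _ Nat.one_le_two_pow]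
  rcases le_total m n with hmn | hnm
  · rw [(ZMod.natCast_eq_zero_iff _ _).2 (pow_dvd_pow 2 hmn), (hop m).op_zero]
  · obtain ⟨k, hk⟩ := ZMod.exists_nsmul_eq_two_pow (m := n) (x m) fun hdvd => hn <| by
      rw [← hx n m hnm, ZMod.castHom_apply, ← ZMod.natCast_val]
      exact (ZMod.natCast_eq_zero_iff _ _).2 hdvd
    rw [← hk]
    exact (hop m).op_nsmul_eq_zero (hcx m) k

theorem mul_eqInf_of_evalP_eq_zero (hop : ∀ n, IsLaverTable (op n)) {a : WA}
    (ha : ∀ n, evalP op cmp n a.toWP = 0) (b : WA) :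
    EqInf op cmp (a.mul b).toWP b.toWP := by
  intro n
  change op n _ _ = _
  rw [ha, (hop n).zero_op]

theorem exists_forall_val_lt_foldl (hop : ∀ n, IsLaverTable (op n))
    (hne : ∀ a : WA, ∃ n, evalP op cmp n a.toWP ≠ 0) (a : WA) (l : List WA) (hl : l ≠ []) :
    ∃ N, ∀ n ≥ N,
      (evalP op cmp n a.toWP).val < (evalP op cmp n (l.foldl WA.mul a).toWP).val := by
  induction l generalizing a with
  | nil => exact absurd rfl hl
  | cons c l ih =>
    obtain ⟨N, hN⟩ := hne (a.mul c)
    have hlt : ∀ n ≥ N,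
        (evalP op cmp n a.toWP).val < (evalP op cmp n (a.mul c).toWP).val := fun n hn =>
      (hop n).val_lt_val_op _ _ (evalP_ne_zero_of_le hop hn hN)
    cases l with
    | nil => exact ⟨N, hlt⟩
    | cons d l =>
      obtain ⟨M, hM⟩ := ih (a.mul c) (List.cons_ne_nil d l)
      exact ⟨max N M, fun n hn => (hlt n (le_of_max_le_left hn)).trans
        (hM n (le_of_max_le_right hn))⟩

theorem ldEq_of_eqInf (hlaws : ∀ n, ALSigma (op n) (cmp n))
    (hirr : ∀ a : WA, ¬ ∃ l : List WA, l ≠ [] ∧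
      EqInf op cmp ((l.foldl WA.mul a).toWP) a.toWP)
    {a b : WA} (hab : EqInf op cmp a.toWP b.toWP) : LDEq a b := by
  obtain ⟨a', b', ha, hb, hcomp⟩ := exists_ldEq_leftSubword a b
  have hab' : EqInf op cmp a'.toWP b'.toWP := fun n =>
    (ha.pEq.eqInf hlaws n).symm.trans ((hab n).trans (hb.pEq.eqInf hlaws n))
  suffices a' = b' from ha.trans (this ▸ hb.symm)
  rcases hcomp with h | h
  · obtain ⟨l, rfl⟩ := h.exists_foldl
    by_contra hne
    exact hirr a' ⟨l, by rintro rfl; exact hne rfl, fun n => (hab' n).symm⟩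
  · obtain ⟨l, rfl⟩ := h.exists_foldl
    by_contra hne
    exact hirr b' ⟨l, by rintro rfl; exact hne rfl, hab'⟩

end Eval

theorem stmt_18 (op cmp : ∀ n : ℕ, ZMod (2 ^ n) → ZMod (2 ^ n) → ZMod (2 ^ n))
    (hlaws : ∀ n, ALSigma (op n) (cmp n))
    (hsucc : ∀ n, ∀ a : ZMod (2 ^ n), op n a 1 = a + 1) :
    List.TFAE
      [ -- (i) A_∞ is free: ≡_∞ coincides with ≡ on W_A
        ∀ a b : WA, EqInf op cmp a.toWP b.toWP ↔ LDEq a b,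
        -- (ii) P_∞ is free: ≡_∞ coincides with ≡_P on W_P
        ∀ a b : WP, EqInf op cmp a b ↔ PEq a b,
        -- (iii) A_∞ satisfies left cancellation
        ∀ a b c : WA, EqInf op cmp ((WA.mul c a).toWP) ((WA.mul c b).toWP) →
          EqInf op cmp a.toWP b.toWP,
        -- (iv) <_L on A_∞ is irreflexive
        ∀ a : WA, ¬ ∃ l : List WA, l ≠ [] ∧
          EqInf op cmp ((l.foldl WA.mul a).toWP) a.toWP,
        -- (v) a <_L b in A_∞ implies [a]_n < [b]_n for all but finitely many n
        ∀ a b : WA, (∃ l : List WA, l ≠ [] ∧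
            EqInf op cmp ((l.foldl WA.mul a).toWP) b.toWP) →
          ∃ N : ℕ, ∀ n ≥ N,
            (evalP op cmp n a.toWP).val < (evalP op cmp n b.toWP).val,
        -- (vi) every word of W_A has a nonzero value in some P_n
        ∀ a : WA, ∃ n : ℕ, evalP op cmp n a.toWP ≠ 0,
        -- (vii) every herringbone has a nonzero value in some P_n
        ∀ k : ℕ, ∃ n : ℕ, evalP op cmp n (herring k).toWP ≠ 0,
        -- (viii) for every k ≥ 1, the word 1·k has a nonzero value in some P_n
        ∀ k : ℕ, 1 ≤ k →
          ∃ n : ℕ, evalP op cmp n (WA.mul WA.one (posWord k)).toWP ≠ 0 ] := by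
  have hop : ∀ n, IsLaverTable (op n) := fun n => ⟨(hlaws n).left_distrib, hsucc n⟩
  tfae_have 1 → 2 := by
    refine fun h a b => ⟨fun hab => PEq.of_mul_one ((h _ _).1 fun n => ?_), PEq.eqInf hlaws⟩
    rw [← a.mul_one_pEq.eqInf hlaws n, ← b.mul_one_pEq.eqInf hlaws n]
    exact congrArg (op n · 1) (hab n)
  tfae_have 2 → 1 := fun h a b =>
    ⟨fun hab => ((h _ _).1 hab).ldEq, fun hab => hab.pEq.eqInf hlaws⟩
  tfae_have 1 → 6 := by
    intro h a
    by_contra! ha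
    have := ((h _ _).1 (mul_eqInf_of_evalP_eq_zero hop ha WA.one)).rightDepth_eq
    simp [WA.rightDepth] at this
  tfae_have 6 → 5 := by
    rintro h a b ⟨l, hl, hab⟩
    obtain ⟨N, hN⟩ := exists_forall_val_lt_foldl hop h a l hl
    exact ⟨N, fun n hn => hab n ▸ hN n hn⟩
  tfae_have 5 → 4 := by
    intro h a ha
    obtain ⟨N, hN⟩ := h a a ha
    exact lt_irrefl _ (hN N le_rfl)
  tfae_have 4 → 1 := fun h a b =>
    ⟨ldEq_of_eqInf hlaws h, fun hab => hab.pEq.eqInf hlaws⟩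
  tfae_have 6 → 3 := by
    intro h a b c hab
    by_contra hne
    obtain ⟨n, hn⟩ := not_forall.1 hne
    obtain ⟨m, hm⟩ := h (c.mul (posWord (2 ^ n)))
    refine hm (evalP_mul_posWord_eq_zero hop c
      (fun m => evalP op cmp m a.toWP - evalP op cmp m b.toWP) (fun n m hnm => ?_)
      (fun m => (hop m).op_sub_eq_zero (hab m)) (sub_ne_zero.2 hn) m)
    rw [map_sub, castHom_evalP hop hnm, castHom_evalP hop hnm]
  tfae_have 3 → 7 := by
    intro h k
    by_contra! hk
    have hstep : ∀ j, EqInf op cmp (herring (j + 1)).toWP (herring j).toWP →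
        EqInf op cmp (herring 1).toWP (herring 0).toWP := by
      intro j
      induction j with
      | zero => exact id
      | succ j ih => exact fun hj => ih (h _ _ _ hj)
    have h1 : EqInf op cmp (herring (k + 1)).toWP (herring k).toWP := by
      intro n
      change op n 1 (evalP op cmp n (herring k).toWP) = _
      rw [hk, (hop n).op_zero]
    have h2 : op 1 1 1 = 1 := hstep k h1 1
    rw [hsucc] at h2
    exact absurd h2 (by decide)
  tfae_have 7 → 6 := by
    intro h a
    by_contra! ha
    obtain ⟨m, hm⟩ := exists_mul_herring_ldEq a
    obtain ⟨n, hn⟩ := h m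
    refine hn ((hop n).eq_zero_of_one_op ?_)
    exact ((hm m le_rfl).pEq.eqInf hlaws n).symm.trans
      (mul_eqInf_of_evalP_eq_zero hop ha (herring m) n)
  tfae_have 6 → 8 := fun h k _ => h _
  tfae_have 8 → 7 := by
    intro h k
    induction k with
    | zero => exact ⟨1, by change (1 : ZMod 2) ≠ 0; decide⟩
    | succ k ih =>
      obtain ⟨n, hn⟩ := ih
      by_contra! hk
      obtain ⟨m, hm⟩ := h (2 ^ n) Nat.one_le_two_pow
      exact hm (evalP_mul_posWord_eq_zero hop WA.one
        (fun m => evalP op cmp m (herring k).toWP) (fun n m hnm => castHom_evalP hop hnm _)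
        hk hn m)
  tfae_finish
end

section
/- There exists a nontrivial embedding algebra if and only if A_∞ is free (i.e. ≡_∞ coincides with ≡ on W_A). -/
/-- `[a]_n`: the evaluation of a word `a ∈ W_A` in `P_n = ℤ/2^nℤ`, interpreting
the generator as `1` and `·` as `*_n` (`op n`). -/
def evalA (op : ∀ n : ℕ, ZMod (2 ^ n) → ZMod (2 ^ n) → ZMod (2 ^ n))
    (n : ℕ) : WA → ZMod (2 ^ n)
  | WA.one => 1
  | WA.mul a b => op n (evalA op n a) (evalA op n b)

/-- The critical point of a strictly increasing `f : ℕ → ℕ` different from the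
identity: the least `n` with `f n > n`. -/
noncomputable def crit (f : ℕ → ℕ) : ℕ := sInf {n : ℕ | n < f n}

/-- There exists a nontrivial embedding algebra: a set `A` of strictly
increasing functions from `ℕ` to `ℕ`, together with a binary operation `·` on
`A` satisfying the left distributive law such that `crit (a·b) = a (crit b)`
whenever `b` is not the identity; nontrivial means `A` contains an element
other than the identity function. -/
def ExistsNontrivialEmbeddingAlgebra : Prop :=
  ∃ (A : Set (ℕ → ℕ)) (opE : (ℕ → ℕ) → (ℕ → ℕ) → (ℕ → ℕ)),
    (∀ f ∈ A, StrictMono f) ∧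
    (∀ a ∈ A, ∀ b ∈ A, opE a b ∈ A) ∧
    (∀ a ∈ A, ∀ b ∈ A, ∀ c ∈ A, opE a (opE b c) = opE (opE a b) (opE a c)) ∧
    (∀ a ∈ A, ∀ b ∈ A, b ≠ id → crit (opE a b) = a (crit b)) ∧
    (∃ a ∈ A, a ≠ id)

/-! ### Expansions and comparison of words -/

instance : Nonempty WA := ⟨.one⟩

instance : Trans LDEq LDEq LDEq := ⟨LDEq.trans⟩

namespace WA

/-- `a.Exp b` holds when `b` is obtained from `a` by applying the left distributive law from
left to right at finitely many positions. -/
inductive Exp : WA → WA → Prop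
  | refl (a : WA) : Exp a a
  | trans {a b c : WA} : Exp a b → Exp b c → Exp a c
  | congr {a a' b b' : WA} : Exp a a' → Exp b b' → Exp (a.mul b) (a'.mul b')
  | ld (a b c : WA) : Exp (a.mul (b.mul c)) ((a.mul b).mul (a.mul c))

/-- Distribute `t` over all leaves of a word. -/
def dist (t : WA) : WA → WA
  | one => t.mul one
  | mul u v => (dist t u).mul (dist t v)

/-- The full expansion of a word: every one-step expansion of `t` expands to `t.full`. -/
def full : WA → WA
  | one => one
  | mul a b => dist a.full b.full

/-- `a.Sub t` holds when `a` is an iterated left subterm of `t`. -/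
inductive Sub (a : WA) : WA → Prop
  | refl : Sub a a
  | mul {t : WA} (u : WA) : Sub a t → Sub a (t.mul u)

/-- The right powers of the generator. -/
def rightPow : ℕ → WA
  | 0 => one
  | n + 1 => one.mul (rightPow n)

/-- The left powers of the generator; `leftPow k` has `k + 1` leaves. -/
def leftPow : ℕ → WA
  | 0 => one
  | n + 1 => (leftPow n).mul one

theorem Exp.ldEq {a b : WA} (h : Exp a b) : LDEq a b := by
  induction h with
  | refl a => exact .refl a
  | trans _ _ h₁ h₂ => exact h₁.trans h₂
  | congr _ _ h₁ h₂ => exact .congr h₁ h₂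
  | ld a b c => exact .ld a b c

theorem exp_mul_dist (t u : WA) : Exp (t.mul u) (dist t u) := by
  induction u with
  | one => exact .refl _
  | mul u v hu hv => exact (Exp.ld t u v).trans (.congr hu hv)

theorem Exp.dist_left {t t' : WA} (h : Exp t t') (u : WA) : Exp (dist t u) (dist t' u) := by
  induction u with
  | one => exact .congr h (.refl _)
  | mul u v hu hv => exact .congr hu hv

theorem Exp.dist_right (t : WA) {u u' : WA} (h : Exp u u') : Exp (dist t u) (dist t u') := by
  induction h with
  | refl a => exact .refl _
  | trans _ _ h₁ h₂ => exact h₁.trans h₂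
  | congr _ _ h₁ h₂ => exact .congr h₁ h₂
  | ld a b c => exact .ld _ _ _

theorem exp_dist_dist (a b c : WA) :
    Exp (dist a (dist b c)) (dist (dist a b) (dist a c)) := by
  induction c with
  | one => exact (Exp.ld _ _ _).trans (.congr (exp_mul_dist _ _) (.refl _))
  | mul u v hu hv => exact .congr hu hv

theorem Exp.full_mono {t t' : WA} (h : Exp t t') : Exp t.full t'.full := by
  induction h with
  | refl a => exact .refl _
  | trans _ _ h₁ h₂ => exact h₁.trans h₂
  | congr _ _ h₁ h₂ => exact (h₁.dist_left _).trans (h₂.dist_right _)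
  | ld a b c => exact exp_dist_dist _ _ _

theorem exp_full (t : WA) : Exp t t.full := by
  induction t with
  | one => exact .refl _
  | mul a b ha hb => exact (Exp.congr ha hb).trans (exp_mul_dist _ _)

theorem Exp.iterate_full {t t' : WA} (h : Exp t t') (n : ℕ) : Exp (full^[n] t) (full^[n] t') := by
  induction n with
  | zero => exact h
  | succ n ih => simpa only [Function.iterate_succ_apply'] using ih.full_mono

theorem exp_iterate_full_of_le (t : WA) {m n : ℕ} (h : m ≤ n) :
    Exp (full^[m] t) (full^[n] t) := by
  induction n, h using Nat.le_induction with
  | base => exact .refl _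
  | succ n _ ih =>
    rw [Function.iterate_succ_apply']
    exact ih.trans (exp_full _)

theorem exp_mul_iterate_full (a b : WA) (n : ℕ) :
    Exp ((full^[n] a).mul (full^[n] b)) (full^[n] (a.mul b)) := by
  induction n with
  | zero => exact .refl _
  | succ n ih =>
    simp only [Function.iterate_succ_apply']
    exact (exp_mul_dist _ _).trans ih.full_mono

theorem Exp.exists_iterate_full {t u : WA} (h : Exp t u) : ∃ n : ℕ, Exp u (full^[n] t) := by
  induction h with
  | refl a => exact ⟨0, .refl _⟩
  | trans _ _ h₁ h₂ =>
    obtain ⟨n, hn⟩ := h₁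
    obtain ⟨m, hm⟩ := h₂
    refine ⟨m + n, ?_⟩
    rw [Function.iterate_add_apply]
    exact hm.trans (hn.iterate_full m)
  | @congr a a' b b' _ _ h₁ h₂ =>
    obtain ⟨n, hn⟩ := h₁
    obtain ⟨m, hm⟩ := h₂
    refine ⟨max n m, Exp.trans (.congr ?_ ?_) (exp_mul_iterate_full a b (max n m))⟩
    · exact hn.trans (exp_iterate_full_of_le _ (le_max_left _ _))
    · exact hm.trans (exp_iterate_full_of_le _ (le_max_right _ _))
  | ld a b c =>
    refine ⟨1, Exp.trans (.congr (.congr (exp_full a) (exp_full b))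
      (.congr (exp_full a) (exp_full c))) ?_⟩
    exact Exp.trans (.congr (exp_mul_dist _ _) (exp_mul_dist _ _))
      (Exp.dist_right a.full (exp_mul_dist b.full c.full))

theorem Exp.confluent {t u v : WA} (hu : Exp t u) (hv : Exp t v) : ∃ w, Exp u w ∧ Exp v w := by
  obtain ⟨n, hn⟩ := hu.exists_iterate_full
  obtain ⟨m, hm⟩ := hv.exists_iterate_full
  exact ⟨full^[max n m] t, hn.trans (exp_iterate_full_of_le _ (le_max_left _ _)),
    hm.trans (exp_iterate_full_of_le _ (le_max_right _ _))⟩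

theorem exists_exp_of_ldEq {a b : WA} (h : LDEq a b) : ∃ c, Exp a c ∧ Exp b c := by
  induction h with
  | refl a => exact ⟨a, .refl _, .refl _⟩
  | symm _ h =>
    obtain ⟨c, h₁, h₂⟩ := h
    exact ⟨c, h₂, h₁⟩
  | trans _ _ ih₁ ih₂ =>
    obtain ⟨c, h₁, h₂⟩ := ih₁
    obtain ⟨d, h₃, h₄⟩ := ih₂
    obtain ⟨w, h₅, h₆⟩ := h₂.confluent h₃
    exact ⟨w, h₁.trans h₅, h₄.trans h₆⟩
  | congr _ _ ih₁ ih₂ =>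
    obtain ⟨c, h₁, h₂⟩ := ih₁
    obtain ⟨d, h₃, h₄⟩ := ih₂
    exact ⟨c.mul d, .congr h₁ h₃, .congr h₂ h₄⟩
  | ld a b c => exact ⟨_, .ld a b c, .refl _⟩

theorem Exp.exists_sub {t t' : WA} (h : Exp t t') :
    ∀ {a : WA}, Sub a t → ∃ a', Exp a a' ∧ Sub a' t' := by
  induction h with
  | refl t => exact fun {a} ha => ⟨a, .refl _, ha⟩
  | trans _ _ h₁ h₂ =>
    intro a ha
    obtain ⟨b, hab, hb⟩ := h₁ ha
    obtain ⟨c, hbc, hc⟩ := h₂ hb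
    exact ⟨c, hab.trans hbc, hc⟩
  | congr e₁ e₂ h₁ _ =>
    intro a ha
    cases ha with
    | refl => exact ⟨_, .congr e₁ e₂, .refl⟩
    | mul _ ha =>
      obtain ⟨a', h, h'⟩ := h₁ ha
      exact ⟨a', h, h'.mul _⟩
  | ld b c d =>
    intro a ha
    cases ha with
    | refl => exact ⟨_, .ld b c d, .refl⟩
    | mul _ ha => exact ⟨a, .refl _, (ha.mul _).mul _⟩

theorem Sub.total {a b c : WA} (ha : Sub a c) (hb : Sub b c) : Sub a b ∨ Sub b a := by
  induction ha with
  | refl => exact .inr hb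
  | mul u ha ih =>
    cases hb with
    | refl => exact .inl (ha.mul u)
    | mul _ hb => exact ih hb

theorem exists_mul_rightPow (a : WA) :
    ∃ m : ℕ, ∀ n ≥ m, LDEq (a.mul (rightPow n)) (rightPow (n + 1)) := by
  induction a with
  | one => exact ⟨0, fun n _ => .refl _⟩
  | mul a b ha hb =>
    obtain ⟨k, hk⟩ := ha
    obtain ⟨l, hl⟩ := hb
    refine ⟨max k l + 1, fun n hn => ?_⟩
    obtain ⟨n, rfl⟩ : ∃ r, n = r + 1 := ⟨n - 1, by omega⟩
    have hkn : k ≤ n := by omega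
    have hln : l ≤ n := by omega
    calc LDEq ((a.mul b).mul (rightPow (n + 1))) ((a.mul b).mul (a.mul (rightPow n))) :=
          .congr (.refl _) (hk n hkn).symm
      LDEq _ (a.mul (b.mul (rightPow n))) := (LDEq.ld _ _ _).symm
      LDEq _ (a.mul (rightPow (n + 1))) := .congr (.refl _) (hl n hln)
      LDEq _ (rightPow (n + 1 + 1)) := hk (n + 1) (by omega)

/-- Any two words are comparable up to left distributivity. -/
theorem comparison (a b : WA) :
    ∃ a' b', LDEq a a' ∧ LDEq b b' ∧ (Sub a' b' ∨ Sub b' a') := by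
  obtain ⟨k, hk⟩ := exists_mul_rightPow a
  obtain ⟨l, hl⟩ := exists_mul_rightPow b
  have h : LDEq (a.mul (rightPow (max k l))) (b.mul (rightPow (max k l))) :=
    (hk _ (le_max_left _ _)).trans (hl _ (le_max_right _ _)).symm
  obtain ⟨c, hac, hbc⟩ := exists_exp_of_ldEq h
  obtain ⟨a', ha, ha'⟩ := hac.exists_sub (Sub.refl.mul _)
  obtain ⟨b', hb, hb'⟩ := hbc.exists_sub (Sub.refl.mul _)
  exact ⟨a', b', ha.ldEq, hb.ldEq, ha'.total hb'⟩

theorem eq_one_iff_of_ldEq {a b : WA} (h : LDEq a b) : a = one ↔ b = one := by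
  induction h with
  | refl => rfl
  | symm _ h => exact h.symm
  | trans _ _ h₁ h₂ => exact h₁.trans h₂
  | congr => simp
  | ld => simp

end WA

/-! ### Laver tables -/

/-- A left distributive operation on `ZMod (2 ^ n)` with `a * 1 = a + 1`. -/
structure IsLaver {n : ℕ} (f : ZMod (2 ^ n) → ZMod (2 ^ n) → ZMod (2 ^ n)) : Prop where
  ld : ∀ a b c, f a (f b c) = f (f a b) (f a c)
  succ : ∀ a, f a 1 = a + 1

theorem ZMod.succ_induction {N : ℕ} [NeZero N] {P : ZMod N → Prop} (h1 : P 1)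
    (hs : ∀ b, P b → P (b + 1)) (b : ZMod N) : P b := by
  have key : ∀ k : ℕ, P ((k : ZMod N) + 1) := by
    intro k
    induction k with
    | zero => simpa using h1
    | succ k ih => simpa using hs _ ih
  simpa using key (b - 1).val

theorem ZMod.dvd_of_val {n j : ℕ} {p q : ZMod (2 ^ n)} (hp : ¬ 2 ^ (j + 1) ∣ p.val)
    (hq : 2 ^ j ∣ q.val) : p ∣ q := by
  have hp0 : p.val ≠ 0 := fun h => hp (h ▸ dvd_zero _)
  obtain ⟨i, u, hu, hpu⟩ := Nat.exists_eq_two_pow_mul_odd hp0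
  have hij : i ≤ j := by
    by_contra h
    exact hp (hpu ▸ (pow_dvd_pow 2 (by omega : j + 1 ≤ i)).mul_right u)
  obtain ⟨t, ht⟩ := hq
  have hunit : IsUnit (u : ZMod (2 ^ n)) :=
    (ZMod.isUnit_iff_coprime u (2 ^ n)).2 (Nat.Coprime.pow_right n hu.coprime_two_right)
  have hp' : p = 2 ^ i * (u : ZMod (2 ^ n)) := by
    rw [← ZMod.natCast_zmod_val p, hpu]; push_cast; rfl
  have hq' : q = 2 ^ j * (t : ZMod (2 ^ n)) := by
    rw [← ZMod.natCast_zmod_val q, ht]; push_cast; rfl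
  rw [hp', hq', hunit.mul_right_dvd]
  exact (pow_dvd_pow 2 hij).mul_right _

theorem ZMod.val_succ_le {N : ℕ} [NeZero N] (a : ZMod N) : (a + 1).val ≤ a.val + 1 := by
  rw [ZMod.val_add]
  refine (Nat.mod_le _ _).trans ?_
  gcongr
  rw [ZMod.val_one_eq_one_mod]
  exact Nat.mod_le _ _

theorem ZMod.val_succ {N : ℕ} [NeZero N] {a : ZMod N} (h : a + 1 ≠ 0) :
    (a + 1).val = a.val + 1 := by
  have hcast : a + 1 = ((a.val + 1 : ℕ) : ZMod N) := by
    rw [Nat.cast_succ, ZMod.natCast_zmod_val]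
  have hlt : a.val + 1 < N := by
    refine lt_of_le_of_ne (ZMod.val_lt a) fun hN => h ?_
    rw [hcast, hN, ZMod.natCast_self]
  rw [hcast, ZMod.val_natCast_of_lt hlt]

namespace IsLaver

variable {n : ℕ} {f : ZMod (2 ^ n) → ZMod (2 ^ n) → ZMod (2 ^ n)}

theorem apply_add_one (hf : IsLaver f) (a b : ZMod (2 ^ n)) : f a (b + 1) = f (f a b) (a + 1) := by
  rw [← hf.succ b, hf.ld, hf.succ a]

theorem zero_apply (hf : IsLaver f) (b : ZMod (2 ^ n)) : f 0 b = b := by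
  induction b using ZMod.succ_induction with
  | h1 => simpa using hf.succ 0
  | hs b ih => rw [hf.apply_add_one, ih, zero_add, hf.succ]

theorem lt_apply (hf : IsLaver f) {a : ZMod (2 ^ n)} (ha : a ≠ 0) (b : ZMod (2 ^ n)) :
    f a b = 0 ∨ a.val < (f a b).val := by
  induction hk : 2 ^ n - a.val using Nat.strong_induction_on generalizing a b with
  | _ k ih =>
    have hsucc : a + 1 = 0 ∨ a.val < (a + 1).val := by
      by_cases h : a + 1 = 0
      · exact .inl h
      · exact .inr (by rw [ZMod.val_succ h]; omega)
    induction b using ZMod.succ_induction with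
    | h1 => rwa [hf.succ]
    | hs b hb =>
      rw [hf.apply_add_one]
      by_cases h0 : f a b = 0
      · rwa [h0, hf.zero_apply]
      · have hlt := hb.resolve_left h0
        have := ZMod.val_lt (f a b)
        exact (ih _ (by omega) h0 (a + 1) rfl).imp_right hlt.trans

/-- Induction along the recursive computation of a Laver table. -/
theorem table_induction (hf : IsLaver f) {P : ZMod (2 ^ n) → ZMod (2 ^ n) → Prop}
    (h0 : ∀ b, P 0 b) (h1 : ∀ a, P a 1)
    (hs : ∀ a b, P a b → P (f a b) (a + 1) → P a (b + 1)) (a b : ZMod (2 ^ n)) : P a b := by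
  induction hk : 2 ^ n - a.val using Nat.strong_induction_on generalizing a b with
  | _ k ih =>
    by_cases ha : a = 0
    · exact ha ▸ h0 b
    induction b using ZMod.succ_induction with
    | h1 => exact h1 a
    | hs b hb =>
      refine hs a b hb ?_
      by_cases hz : f a b = 0
      · exact hz ▸ h0 _
      · have hlt := (hf.lt_apply ha b).resolve_left hz
        have := ZMod.val_lt (f a b)
        exact ih _ (by omega) _ _ rfl

theorem apply_zero (hf : IsLaver f) (a : ZMod (2 ^ n)) : f a 0 = 0 := by
  by_cases ha : a = 0
  · rw [ha, hf.zero_apply]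
  by_contra hc
  have h1 : f (f a 0) (a + 1) = a + 1 := by
    rw [← hf.apply_add_one, zero_add, hf.succ]
  have h2 := (hf.lt_apply ha 0).resolve_left hc
  have h3 := ZMod.val_succ_le a
  rcases hf.lt_apply hc (a + 1) with h | h
  · rw [h1] at h
    have h4 : ((a.val + 1 : ℕ) : ZMod (2 ^ n)) = 0 := by
      rw [Nat.cast_succ, ZMod.natCast_zmod_val, h]
    rw [ZMod.natCast_eq_zero_iff] at h4
    have h5 := ZMod.val_lt (f a 0)
    have h6 := Nat.le_of_dvd (Nat.succ_pos _) h4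
    omega
  · rw [h1] at h
    omega

theorem apply_add_eq (hf : IsLaver f) {a b c : ZMod (2 ^ n)} (h : f a b = f a c)
    (x : ZMod (2 ^ n)) : f a (b + x) = f a (c + x) := by
  induction x using ZMod.succ_induction with
  | h1 => rw [hf.apply_add_one a b, hf.apply_add_one a c, h]
  | hs x ih =>
    rw [← add_assoc, ← add_assoc, hf.apply_add_one a (b + x), hf.apply_add_one a (c + x), ih]

theorem apply_sub_eq_zero (hf : IsLaver f) {a b c : ZMod (2 ^ n)} (h : f a b = f a c) :
    f a (b - c) = 0 := by
  rw [sub_eq_add_neg, hf.apply_add_eq h, add_neg_cancel, hf.apply_zero]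

theorem apply_add_of_eq_zero (hf : IsLaver f) {a b : ZMod (2 ^ n)} (h : f a b = 0)
    (x : ZMod (2 ^ n)) : f a (x + b) = f a x := by
  rw [add_comm, hf.apply_add_eq (h.trans (hf.apply_zero a).symm), zero_add]

theorem apply_eq_zero_of_dvd (hf : IsLaver f) {a b c : ZMod (2 ^ n)} (h : f a b = 0)
    (hbc : b ∣ c) : f a c = 0 := by
  obtain ⟨k, rfl⟩ := hbc
  induction k using ZMod.succ_induction with
  | h1 => rwa [mul_one]
  | hs k ih => rw [mul_add, mul_one, hf.apply_add_of_eq_zero h, ih]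

end IsLaver

section Reduction

variable {n : ℕ} {f : ZMod (2 ^ (n + 1)) → ZMod (2 ^ (n + 1)) → ZMod (2 ^ (n + 1))}

theorem ZMod.two_pow_val (n : ℕ) : ((2 ^ n : ZMod (2 ^ (n + 1)))).val = 2 ^ n := by
  have : ((2 ^ n : ℕ) : ZMod (2 ^ (n + 1))).val = 2 ^ n :=
    ZMod.val_natCast_of_lt (Nat.pow_lt_pow_right (by norm_num) (by omega))
  simpa using this

namespace IsLaver

theorem apply_two_pow (hf : IsLaver f) {a : ZMod (2 ^ (n + 1))} (ha : a ≠ 0) :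
    f a (2 ^ n) = 0 := by
  have hns : ¬ Function.Surjective (f a) := by
    intro hs
    obtain ⟨b, hb⟩ := hs a
    rcases hf.lt_apply ha b with h | h
    · exact ha (hb.symm.trans h)
    · rw [hb] at h; exact lt_irrefl _ h
  have hni : ¬ Function.Injective (f a) := fun h => hns (Finite.surjective_of_injective h)
  simp only [Function.Injective, not_forall] at hni
  obtain ⟨b, c, hbc, hne⟩ := hni
  refine hf.apply_eq_zero_of_dvd (hf.apply_sub_eq_zero hbc) (ZMod.dvd_of_val (j := n) ?_ ?_)
  · intro h
    have h0 := Nat.eq_zero_of_dvd_of_lt h (ZMod.val_lt _)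
    exact hne (sub_eq_zero.1 ((ZMod.val_eq_zero _).1 h0))
  · rw [ZMod.two_pow_val]

theorem two_pow_apply (hf : IsLaver f) {k : ℕ} (hk : k < 2 ^ n) :
    f (2 ^ n) (k + 1 : ℕ) = 2 ^ n + (k + 1 : ℕ) := by
  induction k with
  | zero => simpa using hf.succ (2 ^ n)
  | succ k ih =>
    have hne : (2 ^ n + (k + 1 : ℕ) : ZMod (2 ^ (n + 1))) ≠ 0 := by
      intro h
      have h' : ((2 ^ n + (k + 1) : ℕ) : ZMod (2 ^ (n + 1))) = 0 := by
        rw [← h]; push_cast; rfl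
      rw [ZMod.natCast_eq_zero_iff] at h'
      have := Nat.le_of_dvd (by omega) h'
      rw [pow_succ] at this
      omega
    rw [Nat.cast_succ (k + 1), hf.apply_add_one, ih (by omega), add_comm (2 ^ n) 1,
      hf.apply_add_of_eq_zero (hf.apply_two_pow hne), hf.succ, add_assoc]

theorem two_pow_apply_eq_iff (hf : IsLaver f) (x y : ZMod (2 ^ (n + 1))) :
    f (2 ^ n) x = f (2 ^ n) y ↔ (x.cast : ZMod (2 ^ n)) = y.cast := by
  have hd : 2 ^ n ∣ 2 ^ (n + 1) := pow_dvd_pow 2 (Nat.le_succ n)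
  have hM : (2 ^ n : ZMod (2 ^ (n + 1))) ≠ 0 := by
    intro h
    have := ZMod.two_pow_val n
    rw [h, ZMod.val_zero] at this
    exact absurd this (by positivity)
  have hMM := hf.apply_two_pow hM
  have key : ∀ z : ZMod (2 ^ (n + 1)), f (2 ^ n) z = 0 ↔ (z.cast : ZMod (2 ^ n)) = 0 := by
    intro z
    rw [ZMod.cast_eq_val, ZMod.natCast_eq_zero_iff]
    constructor
    · intro hz
      by_contra hnd
      have hpos : 0 < z.val % 2 ^ n := Nat.pos_of_ne_zero fun h => hnd (Nat.dvd_of_mod_eq_zero h)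
      have hlt : z.val % 2 ^ n < 2 ^ n := Nat.mod_lt _ (by positivity)
      have hdecomp : z = (z.val % 2 ^ n : ℕ) + 2 ^ n * (z.val / 2 ^ n : ℕ) := by
        conv_lhs => rw [← ZMod.natCast_zmod_val z, ← Nat.mod_add_div z.val (2 ^ n)]
        push_cast; rfl
      rw [hdecomp, hf.apply_add_of_eq_zero (hf.apply_eq_zero_of_dvd hMM (dvd_mul_right _ _))] at hz
      obtain ⟨k, hk⟩ : ∃ k, z.val % 2 ^ n = k + 1 := ⟨z.val % 2 ^ n - 1, by omega⟩
      rw [hk, hf.two_pow_apply (by omega)] at hz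
      have h' : ((2 ^ n + (k + 1) : ℕ) : ZMod (2 ^ (n + 1))) = 0 := by
        rw [← hz]; push_cast; rfl
      rw [ZMod.natCast_eq_zero_iff] at h'
      have := Nat.le_of_dvd (by omega) h'
      rw [pow_succ] at this
      omega
    · rintro ⟨t, ht⟩
      refine hf.apply_eq_zero_of_dvd hMM ⟨t, ?_⟩
      rw [← ZMod.natCast_zmod_val z, ht]
      push_cast; rfl
  have hsub : ((x - y).cast : ZMod (2 ^ n)) = x.cast - y.cast := ZMod.cast_sub hd x y
  constructor
  · intro h
    have := (key _).1 (hf.apply_sub_eq_zero h)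
    rwa [hsub, sub_eq_zero] at this
  · intro h
    have h0 := (key (x - y)).2 (by rw [hsub, h, sub_self])
    simpa using hf.apply_add_of_eq_zero h0 y

/-- Reduction modulo `2 ^ n` is a homomorphism of Laver tables. -/
theorem cast_apply (hf : IsLaver f) {g : ZMod (2 ^ n) → ZMod (2 ^ n) → ZMod (2 ^ n)}
    (hg : IsLaver g) (a b : ZMod (2 ^ (n + 1))) :
    ((f a b).cast : ZMod (2 ^ n)) = g a.cast b.cast := by
  have hd : 2 ^ n ∣ 2 ^ (n + 1) := pow_dvd_pow 2 (Nat.le_succ n)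
  have hcc : ∀ x : ZMod (2 ^ n), ((x.cast : ZMod (2 ^ (n + 1))).cast : ZMod (2 ^ n)) = x := by
    intro x
    rw [ZMod.cast_eq_val x, ZMod.cast_natCast hd, ZMod.natCast_zmod_val]
  have hom : ∀ x y : ZMod (2 ^ n), f (2 ^ n) (g x y).cast =
      f (f (2 ^ n) x.cast) (f (2 ^ n) y.cast) := by
    have hstep : ∀ x : ZMod (2 ^ n), f (2 ^ n) (x + 1).cast = f (f (2 ^ n) x.cast) (2 ^ n + 1) := by
      intro x
      rw [← hf.apply_add_one, hf.two_pow_apply_eq_iff, hcc, ZMod.cast_add hd, hcc,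
        ZMod.cast_one hd]
    have hone : f (2 ^ n) (1 : ZMod (2 ^ n)).cast = 2 ^ n + 1 := by
      rw [← hf.succ, hf.two_pow_apply_eq_iff, hcc, ZMod.cast_one hd]
    refine hg.table_induction (fun b => ?_) (fun a => ?_) (fun a b hab h => ?_)
    · rw [hg.zero_apply, ZMod.cast_zero, hf.apply_zero, hf.zero_apply]
    · rw [hg.succ, hone, hstep]
    · rw [hg.apply_add_one, h, hab, hstep a, hstep b, ← hf.ld]
  have h1 : f (2 ^ n) (f a b) = f (2 ^ n) (g a.cast b.cast).cast := by
    rw [hom, hf.ld]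
    congr 1 <;> rw [hf.two_pow_apply_eq_iff, hcc]
  rw [hf.two_pow_apply_eq_iff, hcc] at h1
  exact h1

end IsLaver

end Reduction

/-! ### Evaluating words in Laver tables -/

section Evaluation

variable {op : ∀ n : ℕ, ZMod (2 ^ n) → ZMod (2 ^ n) → ZMod (2 ^ n)}

theorem evalA_eq_of_ldEq (hop : ∀ n, IsLaver (op n)) {a b : WA} (h : LDEq a b) (n : ℕ) :
    evalA op n a = evalA op n b := by
  induction h with
  | refl => rfl
  | symm _ h => exact h.symm
  | trans _ _ h₁ h₂ => exact h₁.trans h₂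
  | congr _ _ h₁ h₂ => simp only [evalA, h₁, h₂]
  | ld a b c => exact (hop n).ld _ _ _

theorem evalA_succ_cast (hop : ∀ n, IsLaver (op n)) (n : ℕ) (a : WA) :
    ((evalA op (n + 1) a).cast : ZMod (2 ^ n)) = evalA op n a := by
  induction a with
  | one => exact ZMod.cast_one (pow_dvd_pow 2 (Nat.le_succ n))
  | mul a b ha hb =>
    simp only [evalA]
    rw [(hop (n + 1)).cast_apply (hop n), ha, hb]

theorem natCast_val_evalA (hop : ∀ n, IsLaver (op n)) {j n : ℕ} (h : j ≤ n) (a : WA) :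
    ((evalA op n a).val : ZMod (2 ^ j)) = evalA op j a := by
  induction n, h using Nat.le_induction with
  | base => exact ZMod.natCast_zmod_val _
  | succ n hjn ih =>
    rw [← ih, ← evalA_succ_cast hop n a, ZMod.cast_eq_val, ZMod.val_natCast]
    rw [ZMod.natCast_eq_natCast_iff]
    exact ((Nat.mod_modEq _ _).of_dvd (pow_dvd_pow 2 hjn)).symm

theorem two_pow_dvd_val_evalA (hop : ∀ n, IsLaver (op n)) {j n : ℕ} (h : j ≤ n) (a : WA) :
    2 ^ j ∣ (evalA op n a).val ↔ evalA op j a = 0 := by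
  rw [← natCast_val_evalA hop h, ZMod.natCast_eq_zero_iff]

theorem evalA_eq_zero_of_le (hop : ∀ n, IsLaver (op n)) {j n : ℕ} (h : j ≤ n) {a : WA}
    (ha : evalA op n a = 0) : evalA op j a = 0 := by
  rw [← two_pow_dvd_val_evalA hop h, ha, ZMod.val_zero]
  exact dvd_zero _

theorem evalA_leftPow (hop : ∀ n, IsLaver (op n)) (n k : ℕ) :
    evalA op n (WA.leftPow k) = (k + 1 : ℕ) := by
  induction k with
  | zero => simp [WA.leftPow, evalA]
  | succ k ih => simp only [WA.leftPow, evalA, ih, (hop n).succ, Nat.cast_succ]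

/-- The left power of the generator which evaluates to `2 ^ m`. -/
def twoPowWord (m : ℕ) : WA := WA.leftPow (2 ^ m - 1)

theorem evalA_twoPowWord (hop : ∀ n, IsLaver (op n)) (n m : ℕ) :
    evalA op n (twoPowWord m) = 2 ^ m := by
  rw [twoPowWord, evalA_leftPow hop, Nat.sub_add_cancel Nat.one_le_two_pow]
  push_cast
  rfl

theorem ZMod.two_pow_eq_zero_iff (n m : ℕ) : (2 ^ m : ZMod (2 ^ n)) = 0 ↔ n ≤ m := by
  rw [← Nat.pow_dvd_pow_iff_le_right (x := 2) (by norm_num), ← ZMod.natCast_eq_zero_iff]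
  push_cast
  rfl

theorem exists_valuation (hop : ∀ n, IsLaver (op n)) {a : WA} (ha : ∃ n, evalA op n a ≠ 0) :
    ∃ v, ∀ n, evalA op n a = 0 ↔ n ≤ v := by
  classical
  have h0 : Nat.find ha ≠ 0 := by
    intro h
    have := Nat.find_spec ha
    rw [h] at this
    exact this (Subsingleton.elim (α := ZMod 1) _ _)
  refine ⟨Nat.find ha - 1, fun n => ⟨fun h => ?_, fun h => ?_⟩⟩
  · by_contra hn
    exact Nat.find_spec ha (evalA_eq_zero_of_le hop (by omega) h)
  · by_contra hn
    have := Nat.find_min' ha hn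
    omega

end Evaluation

/-! ### From a free limit to an embedding algebra -/

/-- `v` is the valuation of words with respect to the tables `op`. -/
def IsValuation (op : ∀ n : ℕ, ZMod (2 ^ n) → ZMod (2 ^ n) → ZMod (2 ^ n)) (v : WA → ℕ) : Prop :=
  ∀ a n, evalA op n a = 0 ↔ n ≤ v a

/-- The action of a word on valuations. -/
def shift (v : WA → ℕ) (a : WA) (m : ℕ) : ℕ := v (a.mul (twoPowWord m))

/-- The bits of the 2-adic integer represented by a word. -/
def bit (op : ∀ n : ℕ, ZMod (2 ^ n) → ZMod (2 ^ n) → ZMod (2 ^ n)) (a : WA) (m : ℕ) : ℕ :=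
  if (evalA op (m + 1) a).val = (evalA op m a).val then 0 else 1

/-- The increasing function attached to a word: it maps `m ^ 2` to `(shift v a m) ^ 2`, and the
image of the block between `m ^ 2` and `(m + 1) ^ 2` records a bit of the word. -/
def embed (op : ∀ n : ℕ, ZMod (2 ^ n) → ZMod (2 ^ n) → ZMod (2 ^ n)) (v : WA → ℕ)
    (a : WA) (k : ℕ) : ℕ :=
  (shift v a k.sqrt) ^ 2 + (k - k.sqrt ^ 2) +
    if k.sqrt ^ 2 < k then bit op a (k.sqrt - 1) else 0

namespace IsValuation

variable {op : ∀ n : ℕ, ZMod (2 ^ n) → ZMod (2 ^ n) → ZMod (2 ^ n)} {v : WA → ℕ}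

theorem mul_eq_shift (hv : IsValuation op v) (hop : ∀ n, IsLaver (op n)) (a b : WA) :
    v (a.mul b) = shift v a (v b) := by
  have key : ∀ n, evalA op n (a.mul b) = 0 ↔ evalA op n (a.mul (twoPowWord (v b))) = 0 := by
    intro n
    simp only [evalA, evalA_twoPowWord hop]
    by_cases hn : n ≤ v b
    · rw [(hv b n).2 hn, (ZMod.two_pow_eq_zero_iff n _).2 hn]
    have hb : 2 ^ v b ∣ (evalA op n b).val :=
      (two_pow_dvd_val_evalA hop (by omega) b).2 ((hv b _).2 le_rfl)
    have hb' : ¬ 2 ^ (v b + 1) ∣ (evalA op n b).val := by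
      rw [two_pow_dvd_val_evalA hop (by omega) b, hv]
      omega
    have hval : (2 ^ v b : ZMod (2 ^ n)).val = 2 ^ v b := by
      have : ((2 ^ v b : ℕ) : ZMod (2 ^ n)).val = 2 ^ v b :=
        ZMod.val_natCast_of_lt (Nat.pow_lt_pow_right (by norm_num) (by omega))
      simpa using this
    constructor
    · exact fun h => (hop n).apply_eq_zero_of_dvd h (ZMod.dvd_of_val hb' hval.symm.dvd)
    · refine fun h => (hop n).apply_eq_zero_of_dvd h (ZMod.dvd_of_val ?_ hb)
      rw [hval, Nat.pow_dvd_pow_iff_le_right (by norm_num)]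
      omega
  have h1 := (key _).1 ((hv _ _).2 le_rfl)
  have h2 := (key _).2 ((hv _ _).2 le_rfl)
  rw [hv] at h1 h2
  exact le_antisymm h1 h2

theorem strictMono_shift (hv : IsValuation op v) (hop : ∀ n, IsLaver (op n)) (a : WA) :
    StrictMono (shift v a) := by
  refine strictMono_nat_of_lt_succ fun m => ?_
  by_contra! hle
  set n := shift v a m with hn
  have hs : evalA op (n + 1) (a.mul (twoPowWord m)) ≠ 0 := by
    rw [Ne, hv]
    exact not_le.2 (Nat.lt_succ_self n)
  have ht : evalA op (n + 1) (a.mul (twoPowWord (m + 1))) ≠ 0 := by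
    rw [Ne, hv]
    exact not_le.2 (Nat.lt_succ_of_le hle)
  have hs' : evalA op n (a.mul (twoPowWord m)) = 0 := (hv _ _).2 le_rfl
  have ht' : evalA op n (a.mul (twoPowWord (m + 1))) = 0 := by
    simp only [evalA, evalA_twoPowWord hop] at hs' ⊢
    exact (hop n).apply_eq_zero_of_dvd hs' (pow_dvd_pow 2 (Nat.le_succ m))
  have key : ∀ w : WA, evalA op n w = 0 → evalA op (n + 1) w ≠ 0 →
      (evalA op (n + 1) w).val = 2 ^ n := by
    intro w h h'
    obtain ⟨t, ht⟩ := (two_pow_dvd_val_evalA hop (Nat.le_succ n) w).2 h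
    have hlt := ZMod.val_lt (evalA op (n + 1) w)
    have h0 : (evalA op (n + 1) w).val ≠ 0 := fun h => h' ((ZMod.val_eq_zero _).1 h)
    rw [ht, pow_succ] at hlt
    have ht2 : t < 2 := lt_of_mul_lt_mul_left hlt (Nat.zero_le _)
    have ht0 : t ≠ 0 := by rintro rfl; exact h0 (by simpa using ht)
    obtain rfl : t = 1 := by omega
    simpa using ht
  have heq := ZMod.val_injective _ ((key _ ht' ht).trans (key _ hs' hs).symm)
  simp only [evalA, evalA_twoPowWord hop] at heq hs
  have := (hop (n + 1)).apply_sub_eq_zero heq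
  rw [show (2 ^ (m + 1) - 2 ^ m : ZMod (2 ^ (n + 1))) = 2 ^ m by ring] at this
  exact hs this

theorem shift_of_lt (hv : IsValuation op v) (hop : ∀ n, IsLaver (op n)) {a : WA} {m : ℕ}
    (h : m < v a) : shift v a m = m := by
  have key : ∀ n ≤ v a, (n ≤ shift v a m ↔ n ≤ m) := by
    intro n hn
    rw [shift, ← hv]
    simp only [evalA, evalA_twoPowWord hop]
    rw [(hv a n).2 hn, (hop n).zero_apply, ZMod.two_pow_eq_zero_iff]
  have h1 := (key m h.le).2 le_rfl
  have h2 := (key (m + 1) h).not.2 (by omega)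
  omega

theorem lt_shift_self (hv : IsValuation op v) (hop : ∀ n, IsLaver (op n)) (a : WA) :
    v a < shift v a (v a) := by
  refine (hv _ _).1 ?_
  simp only [evalA, evalA_twoPowWord hop]
  refine (hop _).apply_two_pow ?_
  rw [Ne, hv]
  omega

theorem lt_shift (hv : IsValuation op v) (hop : ∀ n, IsLaver (op n)) {a : WA} {m : ℕ}
    (h : v a ≤ m) : m < shift v a m := by
  induction m, h using Nat.le_induction with
  | base => exact hv.lt_shift_self hop a
  | succ m _ ih =>
    have : shift v a m < shift v a (m + 1) := hv.strictMono_shift hop a (Nat.lt_succ_self m)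
    omega

theorem bit_of_lt (hv : IsValuation op v) {a : WA} {m : ℕ} (h : m < v a) : bit op a m = 0 := by
  rw [bit, (hv a (m + 1)).2 h, (hv a m).2 h.le, ZMod.val_zero, ZMod.val_zero, if_pos rfl]

theorem bit_le_one (a : WA) (m : ℕ) : bit op a m ≤ 1 := by
  unfold bit
  split_ifs <;> simp

theorem embed_sq_add (a : WA) {m r : ℕ} (hr : r < 2 * m) :
    embed op v a (m ^ 2 + (r + 1)) = shift v a m ^ 2 + (r + 1) + bit op a (m - 1) := by
  have hs : (m ^ 2 + (r + 1)).sqrt = m := by rw [pow_two, Nat.sqrt_add_eq m (by omega)]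
  rw [embed, hs, if_pos (by omega), Nat.add_sub_cancel_left]

theorem embed_sq (a : WA) (m : ℕ) : embed op v a (m ^ 2) = shift v a m ^ 2 := by
  simp [embed, Nat.sqrt_eq']

theorem embed_of_lt (hv : IsValuation op v) (hop : ∀ n, IsLaver (op n)) {a : WA} {k : ℕ}
    (h : k < v a ^ 2) : embed op v a k = k := by
  have hk : k.sqrt < v a := Nat.sqrt_lt'.2 h
  have hle := Nat.sqrt_le' k
  rw [embed, hv.shift_of_lt hop hk, hv.bit_of_lt (by omega), ite_self]
  omega

theorem crit_eq {f : ℕ → ℕ} {c : ℕ} (h : ∀ k < c, f k = k) (hc : c < f c) : crit f = c := by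
  refine le_antisymm (Nat.sInf_le hc) (le_csInf ⟨c, hc⟩ fun k hk => ?_)
  by_contra! hlt
  exact absurd hk (by simp [h k hlt])

theorem crit_embed (hv : IsValuation op v) (hop : ∀ n, IsLaver (op n)) (a : WA) :
    crit (embed op v a) = v a ^ 2 := by
  refine crit_eq (fun k hk => hv.embed_of_lt hop hk) ?_
  rw [embed_sq]
  exact Nat.pow_lt_pow_left (hv.lt_shift_self hop a) two_ne_zero

theorem strictMono_embed (hv : IsValuation op v) (hop : ∀ n, IsLaver (op n)) (a : WA) :
    StrictMono (embed op v a) := by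
  refine strictMono_nat_of_lt_succ fun k => ?_
  obtain ⟨m, r, hr, rfl⟩ : ∃ m r, r ≤ 2 * m ∧ k = m ^ 2 + r := by
    refine ⟨k.sqrt, k - k.sqrt ^ 2, ?_, (Nat.add_sub_cancel' (Nat.sqrt_le' k)).symm⟩
    have h : k < (k.sqrt + 1) ^ 2 := Nat.lt_succ_sqrt' k
    rw [add_sq] at h
    omega
  rcases hr.lt_or_eq with h | rfl
  · rw [add_assoc, embed_sq_add a h]
    rcases r with - | r
    · rw [add_zero, embed_sq]
      omega
    · rw [embed_sq_add a (by omega)]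
      omega
  · rw [show m ^ 2 + 2 * m + 1 = (m + 1) ^ 2 by ring, embed_sq]
    have h1 : shift v a m + 1 ≤ shift v a (m + 1) :=
      hv.strictMono_shift hop a (Nat.lt_succ_self m)
    have h2 : (shift v a m + 1) ^ 2 ≤ shift v a (m + 1) ^ 2 := Nat.pow_le_pow_left h1 2
    have h3 : m ≤ shift v a m := (hv.strictMono_shift hop a).le_apply
    rcases m with - | m
    · rw [mul_zero, add_zero, embed_sq]
      nlinarith
    · rw [show 2 * (m + 1) = 2 * m + 1 + 1 by ring, embed_sq_add a (by omega), Nat.add_sub_cancel]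
      rcases lt_or_ge m (v a) with h | h
      · rw [hv.bit_of_lt h]
        nlinarith
      · have h4 := hv.lt_shift hop h
        have h5 : shift v a m < shift v a (m + 1) :=
          hv.strictMono_shift hop a (Nat.lt_succ_self m)
        have h6 : bit op a m ≤ 1 := bit_le_one a m
        nlinarith

theorem embed_congr (hv : IsValuation op v) {a b : WA} (h : ∀ n, evalA op n a = evalA op n b) :
    embed op v a = embed op v b := by
  have hvv : ∀ x y : WA, (∀ n, evalA op n x = evalA op n y) → v x = v y := by
    intro x y hxy
    refine le_antisymm ?_ ?_
    · rw [← hv, ← hxy, hv]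
    · rw [← hv, hxy, hv]
  have hs : shift v a = shift v b := by
    funext m
    exact hvv _ _ fun n => by simp only [evalA, h n]
  have hb : bit op a = bit op b := by
    funext m
    simp only [bit, h]
  funext k
  simp only [embed, hs, hb]

theorem evalA_eq_of_embed_eq (hop : ∀ n, IsLaver (op n)) {a b : WA}
    (h : embed op v a = embed op v b) (n : ℕ) : evalA op n a = evalA op n b := by
  have hs : ∀ m, shift v a m = shift v b m := by
    intro m
    have := congrFun h (m ^ 2)
    rw [embed_sq, embed_sq] at this
    exact Nat.pow_left_injective two_ne_zero this
  have hb : ∀ m, bit op a m = bit op b m := by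
    intro m
    have h1 := congrFun h ((m + 1) ^ 2 + (0 + 1))
    rw [embed_sq_add _ (by omega), embed_sq_add _ (by omega), hs] at h1
    exact Nat.add_left_cancel h1
  have key : ∀ (w : WA) (m : ℕ), (evalA op (m + 1) w).val = (evalA op m w).val ∨
      (evalA op (m + 1) w).val = (evalA op m w).val + 2 ^ m := by
    intro w m
    have h1 : (evalA op m w).val = (evalA op (m + 1) w).val % 2 ^ m := by
      rw [← natCast_val_evalA hop (Nat.le_succ m) w, ZMod.val_natCast]
    have h2 := ZMod.val_lt (evalA op (m + 1) w)
    have h2' : 2 ^ (m + 1) = 2 ^ m * 2 := pow_succ 2 m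
    rw [h1]
    rcases Nat.lt_or_ge (evalA op (m + 1) w).val (2 ^ m) with h3 | h3
    · exact .inl (Nat.mod_eq_of_lt h3).symm
    · right
      rw [Nat.mod_eq_sub_mod h3, Nat.mod_eq_of_lt (by omega)]
      omega
  induction n with
  | zero => exact Subsingleton.elim (α := ZMod 1) _ _
  | succ n ih =>
    refine ZMod.val_injective _ ?_
    have h1 := hb n
    simp only [bit, ih] at h1
    have hpos : 0 < 2 ^ n := by positivity
    rcases key a n with h2 | h2 <;> rcases key b n with h3 | h3 <;> rw [ih] at h2 <;>
      split_ifs at h1 <;> omega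

/-- If no word vanishes in all Laver tables, then there is a nontrivial embedding algebra. -/
theorem existsNontrivialEmbeddingAlgebra (hv : IsValuation op v) (hop : ∀ n, IsLaver (op n)) :
    ExistsNontrivialEmbeddingAlgebra := by
  have hrep : ∀ a n, evalA op n (Function.invFun (embed op v) (embed op v a)) = evalA op n a :=
    fun a n => evalA_eq_of_embed_eq hop (Function.invFun_eq ⟨a, rfl⟩) n
  let opE : (ℕ → ℕ) → (ℕ → ℕ) → (ℕ → ℕ) := fun f g =>
    embed op v ((Function.invFun (embed op v) f).mul (Function.invFun (embed op v) g))
  have hopE : ∀ a b, opE (embed op v a) (embed op v b) = embed op v (a.mul b) := fun a b =>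
    hv.embed_congr fun n => by simp only [evalA, hrep]
  refine ⟨Set.range (embed op v), opE, ?_, ?_, ?_, ?_, embed op v .one, ⟨_, rfl⟩, ?_⟩
  · rintro _ ⟨a, rfl⟩
    exact hv.strictMono_embed hop a
  · rintro _ ⟨a, rfl⟩ _ ⟨b, rfl⟩
    exact ⟨a.mul b, (hopE a b).symm⟩
  · rintro _ ⟨a, rfl⟩ _ ⟨b, rfl⟩ _ ⟨c, rfl⟩
    simp only [hopE]
    exact hv.embed_congr fun n => (hop n).ld _ _ _
  · rintro _ ⟨a, rfl⟩ _ ⟨b, rfl⟩ _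
    rw [hopE, hv.crit_embed hop, hv.crit_embed hop, embed_sq, hv.mul_eq_shift hop]
  · intro h
    have h1 := congrFun h (v .one ^ 2)
    rw [embed_sq] at h1
    exact (Nat.pow_lt_pow_left (hv.lt_shift_self hop .one) two_ne_zero).ne' h1

end IsValuation

/-! ### From an embedding algebra to a free limit -/

theorem ZMod.val_zero_sub_one_two_pow (n : ℕ) : ((0 : ZMod (2 ^ n)) - 1).val = 2 ^ n - 1 := by
  have hpos : 0 < 2 ^ n := by positivity
  have h := ZMod.natCast_zmod_val ((0 : ZMod (2 ^ n)) - 1)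
  have h1 : ((((0 : ZMod (2 ^ n)) - 1).val + 1 : ℕ) : ZMod (2 ^ n)) = 0 := by
    rw [Nat.cast_succ, h, sub_add_cancel]
  rw [ZMod.natCast_eq_zero_iff] at h1
  have h2 := Nat.le_of_dvd (Nat.succ_pos _) h1
  have h3 := ZMod.val_lt ((0 : ZMod (2 ^ n)) - 1)
  omega

/-- A system of critical points `c` and increasing functions `e` attached to words, compatible
with left distributivity. -/
structure CritSystem (c : WA → ℕ) (e : WA → ℕ → ℕ) : Prop where
  strictMono : ∀ a, StrictMono (e a)
  congr : ∀ {a b}, LDEq a b → c a = c b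
  mul : ∀ a b, c (a.mul b) = e a (c b)
  fix : ∀ a, ∀ x < c a, e a x = x
  move : ∀ a, c a < e a (c a)

/-- The congruence generated by left distributivity and by letting words with critical point
at least `γ` act as the identity. -/
inductive CritRel (c : WA → ℕ) (γ : ℕ) : WA → WA → Prop
  | ofLD {a b : WA} : LDEq a b → CritRel c γ a b
  | symm {a b : WA} : CritRel c γ a b → CritRel c γ b a
  | trans {a b d : WA} : CritRel c γ a b → CritRel c γ b d → CritRel c γ a d
  | drop {w : WA} (a : WA) : γ ≤ c w → CritRel c γ (w.mul a) a

namespace CritRel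

variable {c : WA → ℕ} {e : WA → ℕ → ℕ} {γ : ℕ}

theorem refl (a : WA) : CritRel c γ a a := .ofLD (.refl a)

theorem mono {δ : ℕ} (h : δ ≤ γ) {a b : WA} (hab : CritRel c γ a b) : CritRel c δ a b := by
  induction hab with
  | ofLD h => exact .ofLD h
  | symm _ h => exact h.symm
  | trans _ _ h₁ h₂ => exact h₁.trans h₂
  | drop a hw => exact .drop a (h.trans hw)

theorem mul_left_apply (hc : CritSystem c e) (a : WA) {u v : WA} (h : CritRel c γ u v) :
    CritRel c (e a γ) (a.mul u) (a.mul v) := by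
  induction h with
  | ofLD h => exact .ofLD (.congr (.refl _) h)
  | symm _ h => exact h.symm
  | trans _ _ h₁ h₂ => exact h₁.trans h₂
  | @drop w u hw =>
    refine .trans (.ofLD (.ld _ _ _)) (.drop _ ?_)
    rw [hc.mul]
    exact (hc.strictMono a).monotone hw

theorem mul_left (hc : CritSystem c e) (a : WA) {u v : WA} (h : CritRel c γ u v) :
    CritRel c γ (a.mul u) (a.mul v) :=
  (h.mul_left_apply hc a).mono (hc.strictMono a).le_apply

theorem mul_right (hc : CritSystem c e) {u v : WA} (h : CritRel c γ u v) (b : WA) :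
    CritRel c γ (u.mul b) (v.mul b) := by
  induction h with
  | ofLD h => exact .ofLD (.congr h (.refl _))
  | symm _ h => exact h.symm
  | trans _ _ h₁ h₂ => exact h₁.trans h₂
  | @drop w u hw =>
    exact ((CritRel.drop b hw).symm.mul_left hc (w.mul u)).trans
      ((CritRel.ofLD (.symm (.ld w u b))).trans (.drop _ hw))

theorem mul (hc : CritSystem c e) {u u' v v' : WA} (h : CritRel c γ u u')
    (h' : CritRel c γ v v') : CritRel c γ (u.mul v) (u'.mul v') :=
  (h.mul_right hc v).trans (h'.mul_left hc u')

theorem min_eq (hc : CritSystem c e) {u v : WA} (h : CritRel c γ u v) :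
    min (c u) γ = min (c v) γ := by
  induction h with
  | ofLD h => rw [hc.congr h]
  | symm _ h => exact h.symm
  | trans _ _ h₁ h₂ => exact h₁.trans h₂
  | @drop w u hw =>
    rw [hc.mul]
    rcases lt_or_ge (c u) γ with h | h
    · rw [hc.fix w _ (h.trans_le hw)]
    · rw [min_eq_right h, min_eq_right (h.trans (hc.strictMono w).le_apply)]

end CritRel

namespace CritSystem

variable {c : WA → ℕ} {e : WA → ℕ → ℕ}

theorem lt_apply (hc : CritSystem c e) {a : WA} {x : ℕ} (h : c a ≤ x) : x < e a x := by
  induction x, h using Nat.le_induction with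
  | base => exact hc.move a
  | succ x _ ih =>
    have : e a x < e a (x + 1) := hc.strictMono a (Nat.lt_succ_self x)
    omega

theorem critRel_leftPow_add (hc : CritSystem c e) (p k : ℕ) :
    CritRel c (c (WA.leftPow p)) (WA.leftPow (p + 1 + k)) (WA.leftPow k) := by
  induction k with
  | zero => exact .drop _ le_rfl
  | succ k ih => exact ih.mul_right hc _

theorem critRel_mul_leftPow (hc : CritSystem c e) {p : ℕ}
    (hp : ∀ k < p, c (WA.leftPow k) < c (WA.leftPow p)) {k : ℕ} (hk : k ≤ p) :
    CritRel c (c (WA.leftPow p) + 1) ((WA.leftPow p).mul (WA.leftPow k))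
      (WA.leftPow (p + 1 + k)) := by
  induction k with
  | zero => exact .refl _
  | succ k ih =>
    have hlt : c (WA.leftPow (p + 1 + k)) ≤ c (WA.leftPow p) := by
      have h1 := (hc.critRel_leftPow_add p k).min_eq hc
      have h2 := hp k hk
      omega
    have h1 : CritRel c (c (WA.leftPow p) + 1)
        ((WA.leftPow (p + 1 + k)).mul ((WA.leftPow p).mul .one))
        ((WA.leftPow (p + 1 + k)).mul .one) :=
      ((hc.critRel_leftPow_add p 0).mul_left_apply hc _).mono (hc.lt_apply hlt)
    exact (CritRel.ofLD (.ld _ _ _)).trans (((ih (by omega)).mul_right hc _).trans h1)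

theorem lt_leftPow_two_pow (hc : CritSystem c e) (m : ℕ) :
    ∀ k < 2 ^ m - 1, c (WA.leftPow k) < c (WA.leftPow (2 ^ m - 1)) := by
  induction m with
  | zero => simp
  | succ m ih =>
    have hpos : 0 < 2 ^ m := by positivity
    have hp : 2 ^ (m + 1) - 1 = 2 ^ m - 1 + 1 + (2 ^ m - 1) := by rw [pow_succ]; omega
    rw [hp]
    generalize 2 ^ m - 1 = p at ih
    have h1 := (hc.critRel_mul_leftPow ih le_rfl).min_eq hc
    rw [hc.mul] at h1
    have h2 := hc.move (WA.leftPow p)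
    have h3 : c (WA.leftPow p) < c (WA.leftPow (p + 1 + p)) := by omega
    intro k hk
    rcases lt_trichotomy k p with h | rfl | h
    · exact (ih k h).trans h3
    · exact h3
    · obtain ⟨j, rfl⟩ : ∃ j, k = p + 1 + j := ⟨k - (p + 1), by omega⟩
      have h4 := (hc.critRel_leftPow_add p j).min_eq hc
      have h5 := ih j (by omega)
      omega

theorem le_leftPow_two_pow (hc : CritSystem c e) (m : ℕ) : m ≤ c (WA.leftPow (2 ^ m - 1)) := by
  induction m with
  | zero => exact Nat.zero_le _
  | succ m ih =>
    have h1 : 2 ^ m - 1 < 2 ^ (m + 1) - 1 := by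
      have : 0 < 2 ^ m := by positivity
      rw [pow_succ]
      omega
    exact ih.trans_lt (hc.lt_leftPow_two_pow (m + 1) _ h1)

theorem critRel_apply (hc : CritSystem c e) {n : ℕ}
    {f : ZMod (2 ^ n) → ZMod (2 ^ n) → ZMod (2 ^ n)} (hf : IsLaver f) (a b : ZMod (2 ^ n)) :
    CritRel c (c (WA.leftPow (2 ^ n - 1))) (WA.leftPow (f a b - 1).val)
      ((WA.leftPow (a - 1).val).mul (WA.leftPow (b - 1).val)) := by
  have hzero := ZMod.val_zero_sub_one_two_pow n
  have hstep : ∀ a : ZMod (2 ^ n), CritRel c (c (WA.leftPow (2 ^ n - 1)))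
      (WA.leftPow (a + 1 - 1).val) ((WA.leftPow (a - 1).val).mul .one) := by
    intro a
    rw [add_sub_cancel_right]
    by_cases ha : a = 0
    · rw [ha, hzero, ZMod.val_zero]
      exact (CritRel.drop _ le_rfl).symm
    · have h := ZMod.val_succ (a := a - 1) (by rwa [sub_add_cancel])
      rw [sub_add_cancel] at h
      rw [h]
      exact .refl _
  refine hf.table_induction (P := fun a b => CritRel c (c (WA.leftPow (2 ^ n - 1)))
    (WA.leftPow (f a b - 1).val) ((WA.leftPow (a - 1).val).mul (WA.leftPow (b - 1).val)))
    (fun b => ?_) (fun a => ?_) (fun a b hab h => ?_) a b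
  · rw [hf.zero_apply, hzero]
    exact (CritRel.drop _ le_rfl).symm
  · rw [hf.succ, sub_self, ZMod.val_zero]
    exact hstep a
  · rw [hf.apply_add_one]
    refine h.trans ((hab.mul hc (hstep a)).trans ((CritRel.ofLD (.symm (.ld _ _ _))).trans ?_))
    exact (hstep b).symm.mul_left hc _

variable {op : ∀ n : ℕ, ZMod (2 ^ n) → ZMod (2 ^ n) → ZMod (2 ^ n)}

theorem critRel_evalA (hc : CritSystem c e) (hop : ∀ n, IsLaver (op n)) (n : ℕ) (a : WA) :
    CritRel c (c (WA.leftPow (2 ^ n - 1))) (WA.leftPow (evalA op n a - 1).val) a := by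
  induction a with
  | one =>
    rw [evalA, sub_self, ZMod.val_zero]
    exact .refl _
  | mul a b ha hb => exact (hc.critRel_apply (hop n) _ _).trans (ha.mul hc hb)

theorem evalA_ne_zero (hc : CritSystem c e) (hop : ∀ n, IsLaver (op n)) {n : ℕ} {a : WA}
    (h : c a < n) : evalA op n a ≠ 0 := by
  intro h0
  have h1 := (hc.critRel_evalA hop n a).min_eq hc
  have h2 := hc.le_leftPow_two_pow n
  rw [h0, ZMod.val_zero_sub_one_two_pow] at h1
  omega

end CritSystem

theorem WA.Sub.eq_or_val_evalA_lt {op : ∀ n : ℕ, ZMod (2 ^ n) → ZMod (2 ^ n) → ZMod (2 ^ n)}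
    (hop : ∀ n, IsLaver (op n)) (hne : ∀ a : WA, ∃ m, ∀ n ≥ m, evalA op n a ≠ 0) {a b : WA}
    (h : WA.Sub a b) :
    a = b ∨ ∃ m, ∀ n ≥ m, (evalA op n a).val < (evalA op n b).val := by
  induction h with
  | refl => exact .inl rfl
  | @mul t u _ ih =>
    right
    obtain ⟨k, hk⟩ := hne t
    obtain ⟨l, hl⟩ := hne (t.mul u)
    have hlt : ∀ n ≥ max k l, (evalA op n t).val < (evalA op n (t.mul u)).val := fun n hn =>
      ((hop n).lt_apply (hk n ((le_max_left _ _).trans hn)) _).resolve_left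
        (hl n ((le_max_right _ _).trans hn))
    rcases ih with rfl | ⟨m, hm⟩
    · exact ⟨_, hlt⟩
    · exact ⟨max m (max k l), fun n hn => (hm n ((le_max_left _ _).trans hn)).trans
        (hlt n ((le_max_right _ _).trans hn))⟩

/-- If every word is eventually nonzero in the Laver tables, then words with the same values in
all Laver tables are equal up to left distributivity. -/
theorem ldEq_of_evalA_eq {op : ∀ n : ℕ, ZMod (2 ^ n) → ZMod (2 ^ n) → ZMod (2 ^ n)}
    (hop : ∀ n, IsLaver (op n)) (hne : ∀ a : WA, ∃ m, ∀ n ≥ m, evalA op n a ≠ 0) {a b : WA}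
    (h : ∀ n, evalA op n a = evalA op n b) : LDEq a b := by
  obtain ⟨a', b', ha, hb, hab⟩ := WA.comparison a b
  have heq : ∀ n, evalA op n a' = evalA op n b' := fun n => by
    rw [← evalA_eq_of_ldEq hop ha, ← evalA_eq_of_ldEq hop hb, h]
  suffices a' = b' from ha.trans (this ▸ hb.symm)
  rcases hab with hab | hab
  · rcases hab.eq_or_val_evalA_lt hop hne with h | ⟨m, hm⟩
    · exact h
    · exact absurd (hm m le_rfl) (by rw [heq]; exact lt_irrefl _)
  · rcases hab.eq_or_val_evalA_lt hop hne with h | ⟨m, hm⟩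
    · exact h.symm
    · exact absurd (hm m le_rfl) (by rw [heq]; exact lt_irrefl _)

/-- Evaluation of words in a magma. -/
def WA.evalIn {α : Type*} (m : α → α → α) (x : α) : WA → α
  | WA.one => x
  | WA.mul a b => m (evalIn m x a) (evalIn m x b)

theorem lt_crit {f : ℕ → ℕ} (hf : StrictMono f) (hne : f ≠ id) : crit f < f (crit f) := by
  obtain ⟨n, hn⟩ := Function.ne_iff.1 hne
  exact Nat.sInf_mem (s := {n : ℕ | n < f n}) ⟨n, lt_of_le_of_ne hf.le_apply (Ne.symm hn)⟩

theorem apply_of_lt_crit {f : ℕ → ℕ} (hf : StrictMono f) {x : ℕ} (hx : x < crit f) : f x = x :=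
  le_antisymm (not_lt.1 (Nat.notMem_of_lt_sInf (s := {n : ℕ | n < f n}) hx)) hf.le_apply

theorem crit_id : crit id = 0 := by
  simp [crit]

theorem exists_critSystem (h : ExistsNontrivialEmbeddingAlgebra) : ∃ c e, CritSystem c e := by
  obtain ⟨A, m, hmono, hmem, hld, hcrit, a, haA, hane⟩ := h
  obtain ⟨x, hxA, hxc⟩ : ∃ x ∈ A, 0 < crit x := by
    rcases Nat.eq_zero_or_pos (crit a) with h0 | hpos
    · refine ⟨m a a, hmem a haA a haA, ?_⟩
      rw [hcrit a haA a haA hane]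
      exact (Nat.zero_le _).trans_lt (lt_crit (hmono a haA) hane)
    · exact ⟨a, haA, hpos⟩
  have hE : ∀ w : WA, w.evalIn m x ∈ A := by
    intro w
    induction w with
    | one => exact hxA
    | mul u v hu hv => exact hmem _ hu _ hv
  have hne : ∀ w : WA, 0 < crit (w.evalIn m x) → w.evalIn m x ≠ id := by
    intro w hw h
    rw [h, crit_id] at hw
    exact lt_irrefl _ hw
  have hpos : ∀ w : WA, 0 < crit (w.evalIn m x) := by
    intro w
    induction w with
    | one => exact hxc
    | mul u v _ hv =>
      rw [WA.evalIn, hcrit _ (hE u) _ (hE v) (hne v hv)]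
      exact hv.trans_le (hmono _ (hE u)).le_apply
  refine ⟨fun w => crit (w.evalIn m x), fun w => w.evalIn m x, fun w => hmono _ (hE w), ?_,
    fun u v => hcrit _ (hE u) _ (hE v) (hne v (hpos v)),
    fun w y hy => apply_of_lt_crit (hmono _ (hE w)) hy,
    fun w => lt_crit (hmono _ (hE w)) (hne w (hpos w))⟩
  intro u v huv
  have : u.evalIn m x = v.evalIn m x := by
    induction huv with
    | refl => rfl
    | symm _ h => exact h.symm
    | trans _ _ h₁ h₂ => exact h₁.trans h₂
    | congr _ _ h₁ h₂ => simp only [WA.evalIn, h₁, h₂]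
    | ld a b c => exact hld _ (hE a) _ (hE b) _ (hE c)
  exact congrArg crit this

theorem stmt_19 (op : ∀ n : ℕ, ZMod (2 ^ n) → ZMod (2 ^ n) → ZMod (2 ^ n))
    (hLD : ∀ n, ∀ a b c : ZMod (2 ^ n), op n a (op n b c) = op n (op n a b) (op n a c))
    (hsucc : ∀ n, ∀ a : ZMod (2 ^ n), op n a 1 = a + 1) :
    ExistsNontrivialEmbeddingAlgebra ↔
      (∀ a b : WA, (∀ n : ℕ, evalA op n a = evalA op n b) ↔ LDEq a b) := by
  have hop : ∀ n, IsLaver (op n) := fun n => ⟨hLD n, hsucc n⟩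
  constructor
  · intro h a b
    obtain ⟨c, e, hc⟩ := exists_critSystem h
    exact ⟨ldEq_of_evalA_eq hop fun w => ⟨c w + 1, fun n hn => hc.evalA_ne_zero hop hn⟩,
      evalA_eq_of_ldEq hop⟩
  · intro h
    have hne : ∀ a : WA, ∃ n, evalA op n a ≠ 0 := by
      intro a
      by_contra! ha
      have h1 : LDEq (a.mul .one) .one := (h _ _).1 fun n => by
        simp only [evalA, ha, (hop n).zero_apply]
      exact WA.noConfusion ((WA.eq_one_iff_of_ldEq h1).2 rfl)
    choose v hv using fun a => exists_valuation hop (hne a)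
    exact IsValuation.existsNontrivialEmbeddingAlgebra (v := v) hv hop
end
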